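/- Fix a natural number q ≥ 3 and a real t > 1. Then 𝓑̂(t,q) ∩ (0,∞) = ∅ if 1 < t < t₃(q), and 𝓑̂(t,q) ∩ (0,∞) = {z_c^−(t,q), z_c^+(t,q)} if t ≥ t₃(q), where z_c^±(t,q) = [(−3 − 6(q−2)t − 3(2+(q−2)q)t² − 6(q−2)(q−1)t³ + (q−1)²t⁴) ± √((t−1)³(1−t+qt)³(−9+18t−9qt−t²+qt²))] / (8t(1−2t+qt)³). -/

import Mathlib

noncomputable section

/-- The pair `(Z_n^0(z), Z_n^1(z))` of conditional partition functions of the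
`q`-state Potts model on the depth-`n` rooted binary Cayley tree, in the
field-like variable `z` and temperature-like variable `t`. -/
def ZZpair (q : ℕ) (t : ℝ) : ℕ → ℂ → ℂ × ℂ
  | 0, z => (z⁻¹, 1)
  | n + 1, z =>
      (z⁻¹ * ((ZZpair q t n z).1 + ((q : ℂ) - 1) * (t : ℂ) * (ZZpair q t n z).2) ^ 2,
       ((t : ℂ) * (ZZpair q t n z).1 + (1 + ((q : ℂ) - 2) * (t : ℂ)) * (ZZpair q t n z).2) ^ 2)

/-- The partition function `Ẑ_n(z)` of the `q`-state Potts model on the depth-`n`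
unrooted binary Cayley tree (for `n ≥ 1`):
`Ẑ_n(z) = z⁻¹(Z_{n−1}^0 + (q−1)t·Z_{n−1}^1)³ + (q−1)(t·Z_{n−1}^0 + (1+(q−2)t)·Z_{n−1}^1)³`. -/
def Zunrooted (q : ℕ) (t : ℝ) (n : ℕ) (z : ℂ) : ℂ :=
  z⁻¹ * ((ZZpair q t (n - 1) z).1 + ((q : ℂ) - 1) * (t : ℂ) * (ZZpair q t (n - 1) z).2) ^ 3
    + ((q : ℂ) - 1) *
      ((t : ℂ) * (ZZpair q t (n - 1) z).1
        + (1 + ((q : ℂ) - 2) * (t : ℂ)) * (ZZpair q t (n - 1) z).2) ^ 3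

/-- The accumulation set `𝓑̂(t,q)` of the Lee–Yang zeros of the unrooted binary
Cayley tree: the closure of the set of zeros of some `Ẑ_n`, `n ≥ 1`, in `ℂ ∖ {0}`. -/
def BLYhat (t : ℝ) (q : ℕ) : Set ℂ :=
  closure {z : ℂ | z ≠ 0 ∧ ∃ n : ℕ, 1 ≤ n ∧ Zunrooted q t n z = 0}

/-- The positive real axis `(0,∞)` viewed as a subset of `ℂ`. -/
def posAxis : Set ℂ := {z : ℂ | ∃ x : ℝ, 0 < x ∧ z = (x : ℂ)}

/-- `t₃(q) = 3(3q − 6 + √(9q² − 32q + 32))/(2(q − 1))`. -/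
def tThree (q : ℝ) : ℝ :=
  3 * (3 * q - 6 + Real.sqrt (9 * q ^ 2 - 32 * q + 32)) / (2 * (q - 1))

/-- `z_c^+(t,q)`. -/
def zcPlus (q t : ℝ) : ℝ :=
  ((-3 - 6 * (q - 2) * t - 3 * (2 + (q - 2) * q) * t ^ 2 - 6 * (q - 2) * (q - 1) * t ^ 3
      + (q - 1) ^ 2 * t ^ 4)
    + Real.sqrt ((t - 1) ^ 3 * (1 - t + q * t) ^ 3 * (-9 + 18 * t - 9 * q * t - t ^ 2 + q * t ^ 2)))
    / (8 * t * (1 - 2 * t + q * t) ^ 3)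

/-- `z_c^−(t,q)`. -/
def zcMinus (q t : ℝ) : ℝ :=
  ((-3 - 6 * (q - 2) * t - 3 * (2 + (q - 2) * q) * t ^ 2 - 6 * (q - 2) * (q - 1) * t ^ 3
      + (q - 1) ^ 2 * t ^ 4)
    - Real.sqrt ((t - 1) ^ 3 * (1 - t + q * t) ^ 3 * (-9 + 18 * t - 9 * q * t - t ^ 2 + q * t ^ 2)))
    / (8 * t * (1 - 2 * t + q * t) ^ 3)

section

open Filter Topology Metric Set

/-- A bounded family of holomorphic functions on a disc that tends to zero at points
accumulating at the centre tends to zero uniformly on a smaller disc. -/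
theorem eventually_norm_le_of_frequently_tendsto_zero {ι : Type*} {l : Filter ι} {f : ι → ℂ → ℂ}
    {c : ℂ} {r C : ℝ} (hr : 0 < r) (hf : ∀ i, DifferentiableOn ℂ (f i) (ball c r))
    (hC : ∀ i, ∀ z ∈ ball c r, ‖f i z‖ ≤ C)
    (hS : ∃ᶠ x in 𝓝[≠] c, Tendsto (fun i => f i x) l (𝓝 0)) {ε : ℝ} (hε : 0 < ε) :
    ∀ᶠ i in l, ∀ z ∈ ball c (r / 4), ‖f i z‖ ≤ ε := by
  have key : ∀ (k : ℕ) (f : ι → ℂ → ℂ) (C : ℝ), (∀ i, DifferentiableOn ℂ (f i) (ball c r)) →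
      (∀ i, ∀ z ∈ ball c r, ‖f i z‖ ≤ C) →
      (∃ᶠ x in 𝓝[≠] c, Tendsto (fun i => f i x) l (𝓝 0)) → ∀ ε > 0,
      ∀ᶠ i in l, ∀ z ∈ ball c (r / 4), ‖f i z‖ ≤ ε + (1 / 2) ^ k * C := by
    intro k
    induction k with
    | zero =>
      intro f C hf hC hS ε hε
      refine Eventually.of_forall fun i z hz => ?_
      have := hC i z (ball_subset_ball (by linarith) hz)
      simp; linarith
    | succ k ih =>
      intro f C hf hC hS ε hε
      have hcb : c ∈ ball c r := mem_ball_self hr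
      have hdist : ∀ i, ∀ z ∈ ball c r, ‖f i z - f i c‖ ≤ 2 * C := fun i z hz => by
        have h1 := hC i z hz
        have h2 := hC i c hcb
        have := norm_sub_le (f i z) (f i c)
        linarith
      have hds : ∀ i, ∀ z ∈ ball c r, ‖dslope (f i) c z‖ ≤ 2 * C / r := fun i z hz =>
        Complex.norm_dslope_le_div_of_mapsTo_ball (hf i)
          (fun w hw => by simpa [dist_eq_norm] using hdist i w hw) hz
      have hid : ∀ i z, f i z = f i c + (z - c) * dslope (f i) c z := fun i z => by
        have := sub_smul_dslope (f i) c z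
        rw [smul_eq_mul] at this
        rw [this]; ring
      rcases isEmpty_or_nonempty ι with hι | ⟨⟨i0⟩⟩
      · exact Eventually.of_forall fun i => (hι.false i).elim
      have hC0 : 0 ≤ C := (norm_nonneg _).trans (hC i0 c hcb)
      have hc0 : Tendsto (fun i => f i c) l (𝓝 0) := by
        rw [Metric.tendsto_nhds]
        intro δ hδ
        have hev : ∀ᶠ x in 𝓝[≠] c, x ∈ ball c (min r (δ / 2 / (2 * C / r + 1))) :=
          mem_nhdsWithin_of_mem_nhds (ball_mem_nhds _ (by positivity))
        obtain ⟨x, hx, hxb⟩ := (hS.and_eventually hev).exists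
        rw [Metric.tendsto_nhds] at hx
        filter_upwards [hx (δ / 2) (by positivity)] with i hi
        rw [mem_ball, lt_min_iff, lt_div_iff₀ (by positivity)] at hxb
        rw [dist_zero_right] at hi ⊢
        have h1 := hds i x hxb.1
        have h2 : f i c = f i x - (x - c) * dslope (f i) c x := by
          rw [hid i x]; ring
        have h3 : ‖(x - c) * dslope (f i) c x‖ ≤ dist x c * (2 * C / r) := by
          rw [norm_mul, dist_eq_norm]; gcongr
        have h4 := norm_sub_le (f i x) ((x - c) * dslope (f i) c x)
        rw [h2]
        have h5 := dist_nonneg (x := x) (y := c)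
        linarith [hxb.2]
      have hS' : ∃ᶠ x in 𝓝[≠] c, Tendsto (fun i => dslope (f i) c x) l (𝓝 0) := by
        refine (hS.and_eventually self_mem_nhdsWithin).mono ?_
        rintro x ⟨hx, hxc⟩
        have hxc : x ≠ c := hxc
        have : ∀ i, dslope (f i) c x = (x - c)⁻¹ * (f i x - f i c) := fun i => by
          rw [hid i x]; field_simp [sub_ne_zero.2 hxc]; ring
        simp only [this]
        simpa using (hx.sub hc0).const_mul (x - c)⁻¹
      have hd' : ∀ i, DifferentiableOn ℂ (dslope (f i) c) (ball c r) := fun i =>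
        (Complex.differentiableOn_dslope (ball_mem_nhds c hr)).2 (hf i)
      have := ih _ _ hd' hds hS' (ε / 2 / (r / 4)) (by positivity)
      rw [Metric.tendsto_nhds] at hc0
      filter_upwards [this, hc0 (ε / 2) (by positivity)] with i h1 h2 z hz
      rw [hid i z]
      rw [dist_zero_right] at h2
      have h3 : ‖(z - c) * dslope (f i) c z‖
          ≤ r / 4 * (ε / 2 / (r / 4) + (1 / 2) ^ k * (2 * C / r)) := by
        rw [norm_mul]
        have : ‖z - c‖ ≤ r / 4 := by
          rw [mem_ball, dist_eq_norm] at hz; exact hz.le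
        gcongr
        exact h1 z hz
      have h4 : r / 4 * (ε / 2 / (r / 4) + (1 / 2) ^ k * (2 * C / r))
          = ε / 2 + (1 / 2) ^ (k + 1) * C := by
        rw [pow_succ]; field_simp; ring
      have h5 := norm_add_le (f i c) ((z - c) * dslope (f i) c z)
      linarith
  have hlim : Tendsto (fun k : ℕ => (1 / 2 : ℝ) ^ k * C) atTop (𝓝 0) := by
    simpa using (tendsto_pow_atTop_nhds_zero_of_lt_one (r := (1 / 2 : ℝ))
      (by norm_num) (by norm_num)).mul_const C
  obtain ⟨k, hk⟩ := (hlim.eventually_lt_const (half_pos hε)).exists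
  filter_upwards [key k f C hf hC hS (ε / 2) (half_pos hε)] with i hi z hz
  linarith [hi z hz]

/-- A bounded sequence of holomorphic functions on a disc that converges at points accumulating
at the centre converges to a holomorphic function on a smaller disc. -/
theorem exists_differentiableOn_tendsto_of_frequently {f : ℕ → ℂ → ℂ}
    {c : ℂ} {r C : ℝ} (hr : 0 < r) (hf : ∀ i, DifferentiableOn ℂ (f i) (ball c r))
    (hC : ∀ i, ∀ z ∈ ball c r, ‖f i z‖ ≤ C) {g : ℂ → ℂ}
    (hS : ∃ᶠ x in 𝓝[≠] c, Tendsto (fun i => f i x) atTop (𝓝 (g x))) :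
    ∃ F : ℂ → ℂ, DifferentiableOn ℂ F (ball c (r / 4)) ∧
      ∀ z ∈ ball c (r / 4), Tendsto (fun n => f n z) atTop (𝓝 (F z)) := by
  have hcau : UniformCauchySeqOn f atTop (ball c (r / 4)) := by
    rw [Metric.uniformCauchySeqOn_iff]
    intro ε hε
    have := eventually_norm_le_of_frequently_tendsto_zero (l := atTop ×ˢ atTop)
      (f := fun (p : ℕ × ℕ) z => f p.1 z - f p.2 z) (C := C + C) hr
      (fun p => (hf p.1).sub (hf p.2))
      (fun p z hz => (norm_sub_le _ _).trans (add_le_add (hC _ z hz) (hC _ z hz)))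
      (hS.mono fun x hx => by
        simpa using (hx.comp tendsto_fst).sub (hx.comp tendsto_snd)) (half_pos hε)
    rw [prod_atTop_atTop_eq, eventually_atTop] at this
    obtain ⟨⟨N₁, N₂⟩, hN⟩ := this
    refine ⟨max N₁ N₂, fun m hm n hn z hz => ?_⟩
    rw [dist_eq_norm]
    linarith [hN (m, n) ⟨(le_max_left _ _).trans hm, (le_max_right _ _).trans hn⟩ z hz]
  have hpt : ∀ z, ∃ w, z ∈ ball c (r / 4) → Tendsto (fun n => f n z) atTop (𝓝 w) := by
    intro z
    by_cases hz : z ∈ ball c (r / 4)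
    · obtain ⟨w, hw⟩ := cauchySeq_tendsto_of_complete (hcau.cauchySeq hz)
      exact ⟨w, fun _ => hw⟩
    · exact ⟨0, fun h => absurd h hz⟩
  choose F hF using hpt
  refine ⟨F, ?_, fun z hz => hF z hz⟩
  exact (hcau.tendstoUniformlyOn_of_tendsto fun z hz => hF z hz).tendstoLocallyUniformlyOn.differentiableOn
    (Eventually.of_forall fun n => (hf n).mono (ball_subset_ball (by linarith))) isOpen_ball

/-- A nonvanishing holomorphic function on a disc with real centre that is positive on the real
axis has a holomorphic logarithm that is real on the real axis. -/
theorem exists_log_of_pos_on_real {f : ℂ → ℂ} {x₀ r : ℝ} (hr : 0 < r)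
    (hf : DifferentiableOn ℂ f (ball (x₀ : ℂ) r)) (h0 : ∀ z ∈ ball (x₀ : ℂ) r, f z ≠ 0)
    (hpos : ∀ x : ℝ, (x : ℂ) ∈ ball (x₀ : ℂ) r → ∃ y : ℝ, 0 < y ∧ f x = y) :
    ∃ L : ℂ → ℂ, DifferentiableOn ℂ L (ball (x₀ : ℂ) r) ∧
      (∀ z ∈ ball (x₀ : ℂ) r, Complex.exp (L z) = f z) ∧
      ∀ x : ℝ, (x : ℂ) ∈ ball (x₀ : ℂ) r → (L x).im = 0 := by
  have hcb : (x₀ : ℂ) ∈ ball (x₀ : ℂ) r := mem_ball_self hr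
  have hlog : DifferentiableOn ℂ (fun z => deriv f z / f z) (ball (x₀ : ℂ) r) :=
    (hf.deriv isOpen_ball).div hf h0
  obtain ⟨L, hL0, hL⟩ := hlog.isExactOn_ball.with_val_at (x₀ : ℂ) (Complex.log (f x₀))
  have hLd : DifferentiableOn ℂ L (ball (x₀ : ℂ) r) :=
    fun z hz => (hL z hz).differentiableAt.differentiableWithinAt
  have hexp : ∀ z ∈ ball (x₀ : ℂ) r, Complex.exp (L z) = f z := by
    have hconst : ∀ z ∈ ball (x₀ : ℂ) r,
        f z * Complex.exp (-L z) = f x₀ * Complex.exp (-L x₀) := by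
      intro z hz
      refine (convex_ball (x₀ : ℂ) r).is_const_of_fderivWithin_eq_zero (𝕜 := ℂ)
        (f := fun z => f z * Complex.exp (-L z)) (hf.mul hLd.neg.cexp) ?_ hz hcb
      intro w hw
      have h1 : HasDerivAt f (deriv f w) w :=
        (hf.differentiableAt (isOpen_ball.mem_nhds hw)).hasDerivAt
      have h2 := h1.mul (hL w hw).neg.cexp
      rw [fderivWithin_of_isOpen isOpen_ball hw]
      have h3 : HasDerivAt (fun z => f z * Complex.exp (-L z)) 0 w := by
        refine h2.congr_deriv ?_
        simp only [Pi.neg_apply]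
        linear_combination -Complex.exp (-L w) * div_mul_cancel₀ (deriv f w) (h0 w hw)
      have := h3.hasFDerivAt.fderiv
      rw [this]; ext; simp
    intro z hz
    have := hconst z hz
    rw [hL0, Complex.exp_neg, Complex.exp_neg, Complex.exp_log (h0 _ hcb),
      mul_inv_cancel₀ (h0 _ hcb)] at this
    field_simp at this
    exact this.symm
  refine ⟨L, hLd, hexp, ?_⟩
  intro x hx
  by_contra him
  have hsub : uIcc x₀ x ⊆ {s : ℝ | (s : ℂ) ∈ ball (x₀ : ℂ) r} := by
    intro s hs
    have := abs_sub_left_of_mem_uIcc hs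
    simp only [mem_ofPred_eq, mem_ball, Complex.dist_eq, ← Complex.ofReal_sub,
      Complex.norm_real, Real.norm_eq_abs] at hx ⊢
    linarith
  have hcont : ContinuousOn (fun s : ℝ => (L s).im) (uIcc x₀ x) := by
    refine Complex.continuous_im.comp_continuousOn ?_
    exact hLd.continuousOn.comp Complex.continuous_ofReal.continuousOn hsub
  have h00 : (L x₀).im = 0 := by
    obtain ⟨y, hy, hy'⟩ := hpos x₀ hcb
    rw [hL0, hy', ← Complex.ofReal_log hy.le, Complex.ofReal_im]
  have him2 : ∀ s ∈ uIcc x₀ x, Real.cos (L s).im = 1 := by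
    intro s hs
    obtain ⟨y, hy, hy'⟩ := hpos s (hsub hs)
    have h1 := hexp s (hsub hs)
    rw [hy'] at h1
    have h2 := congrArg Complex.re h1
    have h3 := congrArg (fun w => ‖w‖) h1
    simp only [Complex.norm_exp, Complex.norm_real, Real.norm_eq_abs, abs_of_pos hy] at h3
    rw [Complex.exp_re, Complex.ofReal_re, h3] at h2
    field_simp at h2
    exact h2
  have hiv := intermediate_value_uIcc hcont
  simp only [h00] at hiv
  obtain ⟨k, hk⟩ := (Real.cos_eq_one_iff _).1 (him2 x right_mem_uIcc)
  have hk0 : k ≠ 0 := by rintro rfl; simp at hk; exact him hk.symm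
  have hpi := Real.pi_pos
  have : Real.pi ∈ uIcc 0 (L x).im ∨ -Real.pi ∈ uIcc 0 (L x).im := by
    rcases lt_or_gt_of_ne hk0 with h | h
    · right
      have : (k : ℝ) ≤ -1 := by exact_mod_cast Int.le_sub_one_of_lt h
      rw [mem_uIcc]; right; constructor <;> nlinarith
    · left
      have : (1 : ℝ) ≤ k := by exact_mod_cast h
      rw [mem_uIcc]; left; constructor <;> nlinarith
  rcases this with h | h
  · obtain ⟨s, hs, hs'⟩ := hiv h
    have := him2 s hs
    simp only at hs'
    rw [hs', Real.cos_pi] at this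
    norm_num at this
  · obtain ⟨s, hs, hs'⟩ := hiv h
    have := him2 s hs
    simp only at hs'
    rw [hs', Real.cos_neg, Real.cos_pi] at this
    norm_num at this

/-- Homogeneous coordinates of the `n`-th iterate of `w ↦ (w² + κz) / (tw² + cz)` at `w = 1`. -/
def pottsPair {K : Type*} [CommSemiring K] (t κ c z : K) : ℕ → K × K
  | 0 => (1, 1)
  | n + 1 => ((pottsPair t κ c z n).1 ^ 2 + κ * z * (pottsPair t κ c z n).2 ^ 2,
      t * (pottsPair t κ c z n).1 ^ 2 + c * z * (pottsPair t κ c z n).2 ^ 2)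

/-- The Potts renormalization map. -/
def pottsStep {K : Type*} [Field K] (t κ c z w : K) : K :=
  (w ^ 2 + κ * z) / (t * w ^ 2 + c * z)

/-- The ratio of the homogeneous coordinates. -/
def pottsRatio {K : Type*} [Field K] (t κ c z : K) (n : ℕ) : K :=
  (pottsPair t κ c z n).1 / (pottsPair t κ c z n).2

/-- The conditions on the real parameters under which the dynamics is studied. -/
structure PottsParams (t κ c : ℝ) : Prop where
  one_lt : 1 < t
  c_pos : 0 < c
  add_one : κ + 1 = t + c
  base_pos : 0 < 2 * t * c - (t * κ + 3 * c) + 2 * κ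

theorem pottsRatio_succ {K : Type*} [Field K] {t κ c z : K} {n : ℕ}
    (h : (pottsPair t κ c z n).2 ≠ 0) :
    pottsRatio t κ c z (n + 1) = pottsStep t κ c z (pottsRatio t κ c z n) := by
  have h2 : (pottsPair t κ c z n).2 ^ 2 ≠ 0 := pow_ne_zero _ h
  simp only [pottsRatio, pottsStep, pottsPair]
  rw [← mul_div_mul_left (((pottsPair t κ c z n).1 / (pottsPair t κ c z n).2) ^ 2 + κ * z) _ h2]
  congr 1 <;> field_simp

theorem pottsPair_ofReal (t κ c z : ℝ) (n : ℕ) :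
    pottsPair (t : ℂ) (κ : ℂ) (c : ℂ) (z : ℂ) n =
      (((pottsPair t κ c z n).1 : ℂ), ((pottsPair t κ c z n).2 : ℂ)) := by
  induction n with
  | zero => simp [pottsPair]
  | succ n ih => simp [pottsPair, ih]

theorem pottsRatio_ofReal (t κ c z : ℝ) (n : ℕ) :
    pottsRatio (t : ℂ) (κ : ℂ) (c : ℂ) (z : ℂ) n = ((pottsRatio t κ c z n : ℝ) : ℂ) := by
  simp [pottsRatio, pottsPair_ofReal]

/-- The deviation from a fixed point factors along the orbit. -/
theorem pottsPair_succ_sub_fixed {K : Type*} [Field K] {t κ c z X : K}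
    (hX : X ^ 2 * (t * X - 1) = z * (κ - c * X)) (n : ℕ) :
    (pottsPair t κ c z (n + 1)).1 - X * (pottsPair t κ c z (n + 1)).2 =
      (1 - t * X) * ((pottsPair t κ c z n).1 - X * (pottsPair t κ c z n).2) *
        ((pottsPair t κ c z n).1 + X * (pottsPair t κ c z n).2) := by
  simp only [pottsPair]
  linear_combination -(pottsPair t κ c z n).2 ^ 2 * hX

/-- An orbit can converge to a repelling fixed point only by landing on it. -/
theorem exists_pottsPair_eq_of_repelling {K : Type*} [NormedField K] {t κ c z X : K}
    (hX : X ^ 2 * (t * X - 1) = z * (κ - c * X))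
    (hB : ∀ᶠ n in atTop, (pottsPair t κ c z n).2 ≠ 0)
    (hlim : Tendsto (pottsRatio t κ c z) atTop (𝓝 X))
    (hden : t * X ^ 2 + c * z ≠ 0)
    (hrep : ‖t * X ^ 2 + c * z‖ < ‖2 * X * (1 - t * X)‖) :
    ∃ n, (pottsPair t κ c z n).1 - X * (pottsPair t κ c z n).2 = 0 := by
  have hstep : ∀ w, t * w ^ 2 + c * z ≠ 0 → pottsStep t κ c z w - X =
      (1 - t * X) * (w + X) / (t * w ^ 2 + c * z) * (w - X) := by
    intro w hw
    rw [pottsStep, div_sub' hw, div_mul_eq_mul_div]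
    congr 1
    linear_combination -hX
  have hcont : Tendsto (fun w => ‖(1 - t * X) * (w + X) / (t * w ^ 2 + c * z)‖) (𝓝 X)
      (𝓝 ‖(1 - t * X) * (X + X) / (t * X ^ 2 + c * z)‖) := by
    apply Tendsto.norm
    apply Tendsto.div _ _ hden
    · exact Continuous.tendsto (by fun_prop) X
    · exact Continuous.tendsto (by fun_prop) X
  have hgt : 1 < ‖(1 - t * X) * (X + X) / (t * X ^ 2 + c * z)‖ := by
    rw [norm_div, one_lt_div (norm_pos_iff.2 hden)]
    rw [show (1 - t * X) * (X + X) = 2 * X * (1 - t * X) by ring]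
    exact hrep
  have hdcont : Tendsto (fun w => t * w ^ 2 + c * z) (𝓝 X) (𝓝 (t * X ^ 2 + c * z)) :=
    Continuous.tendsto (by fun_prop) X
  have hev := hlim.eventually ((hcont.eventually_const_lt hgt).and
    (hdcont.eventually_ne hden))
  obtain ⟨N, hN⟩ := eventually_atTop.1 (hev.and hB)
  have hmono : ∀ k, ‖pottsRatio t κ c z N - X‖ ≤ ‖pottsRatio t κ c z (N + k) - X‖ := by
    intro k
    induction k with
    | zero => simp
    | succ k ih =>
      obtain ⟨⟨h1, h2⟩, h3⟩ := hN (N + k) (by omega)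
      refine ih.trans ?_
      rw [← add_assoc, pottsRatio_succ h3, hstep _ h2, norm_mul]
      exact le_mul_of_one_le_left (norm_nonneg _) h1.le
  have h0 : Tendsto (fun k => ‖pottsRatio t κ c z (N + k) - X‖) atTop (𝓝 0) := by
    have := (hlim.comp (tendsto_add_atTop_nat N)).sub_const X
    simp only [sub_self] at this
    have h := this.norm
    simp only [norm_zero] at h
    refine h.congr fun k => ?_
    simp [add_comm]
  have h1 := ge_of_tendsto' h0 hmono
  have h2 : pottsRatio t κ c z N - X = 0 := norm_le_zero_iff.1 h1
  refine ⟨N, ?_⟩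
  have h3 := (hN N le_rfl).2
  rw [pottsRatio, div_sub' h3, div_eq_zero_iff] at h2
  rcases h2 with h2 | h2
  · linear_combination h2
  · exact absurd h2 h3

namespace PottsParams

variable {t κ c : ℝ}

theorem t_pos (h : PottsParams t κ c) : 0 < t := by linarith [h.one_lt]

theorem c_lt (h : PottsParams t κ c) : c < κ := by linarith [h.one_lt, h.add_one]

theorem κ_pos (h : PottsParams t κ c) : 0 < κ := h.c_pos.trans h.c_lt

theorem d_pos (h : PottsParams t κ c) : 0 < t * κ - c := by
  have h1 : κ = t + c - 1 := by linarith [h.add_one]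
  have : t * κ - c = (t - 1) * (t + c) := by rw [h1]; ring
  rw [this]
  exact mul_pos (by linarith [h.one_lt]) (by linarith [h.one_lt, h.c_pos])

theorem den_pos (h : PottsParams t κ c) {z : ℝ} (hz : 0 < z) (w : ℝ) :
    0 < t * w ^ 2 + c * z := by
  have := mul_pos h.c_pos hz
  have := mul_nonneg h.t_pos.le (sq_nonneg w)
  linarith

theorem pair_pos (h : PottsParams t κ c) {z : ℝ} (hz : 0 < z) (n : ℕ) :
    0 < (pottsPair t κ c z n).1 ∧ 0 < (pottsPair t κ c z n).2 := by
  have := h.t_pos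
  have := h.κ_pos
  have := h.c_pos
  induction n with
  | zero => simp [pottsPair]
  | succ n ih =>
    obtain ⟨h1, h2⟩ := ih
    simp only [pottsPair]
    constructor <;> positivity

theorem step_lt_step (h : PottsParams t κ c) {z : ℝ} (hz : 0 < z) {x y : ℝ} (hx : 0 ≤ x)
    (hxy : x < y) : pottsStep t κ c z y < pottsStep t κ c z x := by
  rw [pottsStep, pottsStep, div_lt_div_iff₀ (h.den_pos hz y) (h.den_pos hz x)]
  have h1 : 0 < (y - x) * (y + x) := mul_pos (by linarith) (by linarith)
  have h2 := mul_pos (mul_pos hz h.d_pos) h1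
  nlinarith

theorem step_mem (h : PottsParams t κ c) {z : ℝ} (hz : 0 < z) (x : ℝ) :
    pottsStep t κ c z x ∈ Icc (1 / t) (κ / c) := by
  have h1 := h.d_pos
  rw [pottsStep, mem_Icc, div_le_div_iff₀ h.t_pos (h.den_pos hz x),
    div_le_div_iff₀ (h.den_pos hz x) h.c_pos]
  have h2 := mul_pos h1 hz
  have h3 := mul_nonneg h1.le (sq_nonneg x)
  constructor <;> nlinarith

theorem ratio_succ (h : PottsParams t κ c) {z : ℝ} (hz : 0 < z) (n : ℕ) :
    pottsRatio t κ c z (n + 1) = pottsStep t κ c z (pottsRatio t κ c z n) :=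
  pottsRatio_succ (h.pair_pos hz n).2.ne'

theorem ratio_mem (h : PottsParams t κ c) {z : ℝ} (hz : 0 < z) (n : ℕ) :
    pottsRatio t κ c z n ∈ Icc (1 / t) (κ / c) := by
  cases n with
  | zero =>
    simp only [pottsRatio, pottsPair, mem_Icc]
    rw [div_le_div_iff₀ h.t_pos one_pos, div_le_div_iff₀ one_pos h.c_pos]
    constructor <;> linarith [h.one_lt, h.c_lt]
  | succ n => rw [h.ratio_succ hz]; exact h.step_mem hz _

theorem ratio_pos (h : PottsParams t κ c) {z : ℝ} (hz : 0 < z) (n : ℕ) :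
    0 < pottsRatio t κ c z n :=
  (one_div_pos.2 h.t_pos).trans_le (h.ratio_mem hz n).1

theorem continuous_step (h : PottsParams t κ c) {z : ℝ} (hz : 0 < z) :
    Continuous (pottsStep t κ c z) := by
  unfold pottsStep
  exact Continuous.div (by fun_prop) (by fun_prop) fun w => (h.den_pos hz w).ne'

/-- The even part of the orbit of `1` converges to a point of period at most two. -/
theorem exists_tendsto_even (h : PottsParams t κ c) {z : ℝ} (hz : 0 < z) :
    ∃ p, 0 < p ∧ Tendsto (fun n => pottsRatio t κ c z (2 * n)) atTop (𝓝 p) ∧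
      pottsStep t κ c z (pottsStep t κ c z p) = p := by
  set u : ℕ → ℝ := fun n => pottsRatio t κ c z (2 * n) with hu
  have hsucc : ∀ n, u (n + 1) = pottsStep t κ c z (pottsStep t κ c z (u n)) := fun n => by
    simp only [hu]
    rw [← h.ratio_succ hz, ← h.ratio_succ hz]; ring_nf
  have hmem : ∀ n, u n ∈ Icc (1 / t) (κ / c) := fun n => h.ratio_mem hz _
  have hstep0 : ∀ x, 0 ≤ pottsStep t κ c z x := fun x =>
    (one_div_pos.2 h.t_pos).le.trans (h.step_mem hz x).1
  have hle : ∀ x y, 0 ≤ x → x ≤ y → pottsStep t κ c z (pottsStep t κ c z x) ≤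
      pottsStep t κ c z (pottsStep t κ c z y) := by
    intro x y hx hxy
    rcases hxy.eq_or_lt with rfl | hxy
    · exact le_rfl
    · exact (h.step_lt_step hz (hstep0 _) (h.step_lt_step hz hx hxy)).le
  have hu0 : ∀ n, 0 ≤ u n := fun n => (h.ratio_pos hz _).le
  have hconv : ∃ p, Tendsto u atTop (𝓝 p) := by
    rcases le_total (u 0) (u 1) with h01 | h01
    · have hm : Monotone u := by
        apply monotone_nat_of_le_succ
        intro n
        induction n with
        | zero => exact h01
        | succ n ih => simpa only [← hsucc] using hle _ _ (hu0 n) ih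
      exact ⟨_, tendsto_atTop_ciSup hm ⟨κ / c, by rintro _ ⟨n, rfl⟩; exact (hmem n).2⟩⟩
    · have hm : Antitone u := by
        apply antitone_nat_of_succ_le
        intro n
        induction n with
        | zero => exact h01
        | succ n ih => simpa only [← hsucc] using hle _ _ (hu0 (n + 1)) ih
      exact ⟨_, tendsto_atTop_ciInf hm ⟨1 / t, by rintro _ ⟨n, rfl⟩; exact (hmem n).1⟩⟩
  obtain ⟨p, hp⟩ := hconv
  refine ⟨p, (one_div_pos.2 h.t_pos).trans_le (ge_of_tendsto' hp fun n => (hmem n).1), hp, ?_⟩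
  have hc := ((h.continuous_step hz).comp (h.continuous_step hz)).tendsto p
  have h1 := hc.comp hp
  have h2 := hp.comp (tendsto_add_atTop_nat 1)
  refine tendsto_nhds_unique h1 (h2.congr fun n => ?_)
  simp [hsucc]

theorem step_eq_iff (h : PottsParams t κ c) {z : ℝ} (hz : 0 < z) {x y : ℝ} :
    pottsStep t κ c z x = y ↔ y * (t * x ^ 2 + c * z) = x ^ 2 + κ * z := by
  rw [pottsStep, div_eq_iff (h.den_pos hz x).ne', eq_comm]

/-- Sum and product of the two points of a genuine two-cycle. -/
theorem cycle_sum_mul (h : PottsParams t κ c) {z : ℝ} (hz : 0 < z) {p p' : ℝ}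
    (h1 : pottsStep t κ c z p = p') (h2 : pottsStep t κ c z p' = p) (hne : p ≠ p') :
    (1 + t * c * z) * (p + p') = z * (t * κ - c) ∧
      (1 + t * c * z) * (p * p') = z * (κ + c ^ 2 * z) ∧ t * (p * p') = p + p' + c * z := by
  rw [h.step_eq_iff hz] at h1 h2
  have hne' : p - p' ≠ 0 := sub_ne_zero.2 hne
  have e1 : t * (p * p') = p + p' + c * z := by
    apply mul_left_cancel₀ hne'
    linear_combination h1 - h2
  have e2 : t * (p * p') * (p + p') = (p + p') ^ 2 - p * p' + κ * z := by
    apply mul_left_cancel₀ hne'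
    linear_combination p * h1 - p' * h2
  have e3 : c * z * (p + p') = κ * z - p * p' := by
    linear_combination e2 - (p + p') * e1
  refine ⟨?_, ?_, e1⟩
  · linear_combination t * e3 - e1
  · linear_combination c * z * e1 + e3

theorem fixed_pos (h : PottsParams t κ c) {z X : ℝ} (hz : 0 < z) (hX0 : 0 < X)
    (hX : X ^ 2 * (t * X - 1) = z * (κ - c * X)) : 0 < t * X - 1 ∧ 0 < κ - c * X := by
  have hd := h.d_pos
  have h1 : c * (t * X - 1) + t * (κ - c * X) = t * κ - c := by ring
  have hc := h.c_pos
  have ht := h.t_pos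
  have hX2 : 0 < X ^ 2 := by positivity
  have hv : 0 < t * X - 1 := by
    by_contra hv
    push Not at hv
    have h2 : X ^ 2 * (t * X - 1) ≤ 0 := mul_nonpos_of_nonneg_of_nonpos hX2.le hv
    have h3 : κ - c * X ≤ 0 := by
      by_contra h4
      push Not at h4
      have := mul_pos hz h4
      linarith
    nlinarith
  refine ⟨hv, ?_⟩
  have h2 := mul_pos hX2 hv
  rw [hX] at h2
  exact (mul_pos_iff_of_pos_left hz).1 h2

theorem step_fixed_iff (h : PottsParams t κ c) {z X : ℝ} (hz : 0 < z) :
    pottsStep t κ c z X = X ↔ X ^ 2 * (t * X - 1) = z * (κ - c * X) := by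
  rw [h.step_eq_iff hz]
  constructor <;> intro h <;> linear_combination h

/-- Value of the cycle quadratic at a fixed point. -/
theorem cycle_quadratic_at_fixed {z X : ℝ} (hX : X ^ 2 * (t * X - 1) = z * (κ - c * X)) :
    ((1 + t * c * z) * X ^ 2 - z * (t * κ - c) * X + z * (κ + c ^ 2 * z)) * (κ - c * X) ^ 2 =
      X ^ 3 * (t * κ - c) * (2 * t * c * X ^ 2 - (t * κ + 3 * c) * X + 2 * κ) := by
  have e : z * (κ - c * X) = X ^ 2 * (t * X - 1) := hX.symm
  linear_combination (t * c * X ^ 2 * (κ - c * X) - (t * κ - c) * X * (κ - c * X)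
    + κ * (κ - c * X) + c ^ 2 * (z * (κ - c * X) + X ^ 2 * (t * X - 1))) * e

/-- If the even part of the orbit of `1` converges to a fixed point, so does the orbit. -/
theorem tendsto_of_tendsto_even (h : PottsParams t κ c) {z p : ℝ} (hz : 0 < z)
    (hfix : pottsStep t κ c z p = p)
    (hp : Tendsto (fun n => pottsRatio t κ c z (2 * n)) atTop (𝓝 p)) :
    Tendsto (pottsRatio t κ c z) atTop (𝓝 p) := by
  have hodd : Tendsto (fun n => pottsRatio t κ c z (2 * n + 1)) atTop (𝓝 p) := by
    have := ((h.continuous_step hz).tendsto p).comp hp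
    rw [hfix] at this
    exact this.congr fun n => (h.ratio_succ hz _).symm
  rw [Metric.tendsto_atTop] at hp hodd ⊢
  intro ε hε
  obtain ⟨N₁, h1⟩ := hp ε hε
  obtain ⟨N₂, h2⟩ := hodd ε hε
  refine ⟨2 * (N₁ + N₂), fun n hn => ?_⟩
  rcases Nat.even_or_odd' n with ⟨k, rfl | rfl⟩
  · exact h1 k (by omega)
  · exact h2 k (by omega)

/-- The orbit of `1` converges to an attracting fixed point. -/
theorem tendsto_fixed (h : PottsParams t κ c) {z X : ℝ} (hz : 0 < z) (hX0 : 0 < X)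
    (hX : X ^ 2 * (t * X - 1) = z * (κ - c * X))
    (hR : 0 < 2 * t * c * X ^ 2 - (t * κ + 3 * c) * X + 2 * κ) :
    Tendsto (pottsRatio t κ c z) atTop (𝓝 X) := by
  obtain ⟨p, hp0, hp, hpp⟩ := h.exists_tendsto_even hz
  have hfix := (h.step_fixed_iff hz).2 hX
  obtain ⟨hv, hu⟩ := h.fixed_pos hz hX0 hX
  have hp' : 0 < pottsStep t κ c z p :=
    (one_div_pos.2 h.t_pos).trans_le (h.step_mem hz p).1
  have hpX : p = X := by
    by_cases hpf : pottsStep t κ c z p = p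
    · rcases lt_trichotomy p X with hlt | heq | hgt
      · have := h.step_lt_step hz hp0.le hlt
        linarith
      · exact heq
      · have := h.step_lt_step hz hX0.le hgt
        linarith
    · exfalso
      set p' := pottsStep t κ c z p with hp'def
      obtain ⟨h1, h2, -⟩ := h.cycle_sum_mul hz hp'def.symm hpp (Ne.symm hpf)
      have h3 := cycle_quadratic_at_fixed hX
      have hτ : 0 < 1 + t * c * z := by
        have := mul_pos (mul_pos h.t_pos h.c_pos) hz
        linarith
      have h4 : (1 + t * c * z) * X ^ 2 - z * (t * κ - c) * X + z * (κ + c ^ 2 * z) =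
          (1 + t * c * z) * ((X - p) * (X - p')) := by
        linear_combination X * h1 - h2
      have h5 : 0 < X ^ 3 * (t * κ - c) * (2 * t * c * X ^ 2 - (t * κ + 3 * c) * X + 2 * κ) :=
        mul_pos (mul_pos (by positivity) h.d_pos) hR
      rw [← h3, h4] at h5
      have h6 : 0 < (X - p) * (X - p') := by
        have := (mul_pos_iff_of_pos_right (by positivity)).1 h5
        exact (mul_pos_iff_of_pos_left hτ).1 this
      rcases mul_pos_iff.1 h6 with ⟨h7, h8⟩ | ⟨h7, h8⟩
      · have := h.step_lt_step hz hp0.le (sub_pos.1 h7)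
        linarith
      · have := h.step_lt_step hz hX0.le (sub_neg.1 h7)
        linarith
  subst hpX
  exact h.tendsto_of_tendsto_even hz hfix hp

/-- At a real fixed point other than `1` the orbit of `1` never lands. -/
theorem pair_sub_fixed_ne_zero (h : PottsParams t κ c) {z X : ℝ} (hz : 0 < z) (hX0 : 0 < X)
    (hX : X ^ 2 * (t * X - 1) = z * (κ - c * X)) (hX1 : X ≠ 1) (n : ℕ) :
    (pottsPair t κ c z n).1 - X * (pottsPair t κ c z n).2 ≠ 0 := by
  obtain ⟨hv, hu⟩ := h.fixed_pos hz hX0 hX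
  induction n with
  | zero => simpa [pottsPair, sub_eq_zero] using hX1.symm
  | succ n ih =>
    rw [pottsPair_succ_sub_fixed hX]
    obtain ⟨h1, h2⟩ := h.pair_pos hz n
    have : 0 < (pottsPair t κ c z n).1 + X * (pottsPair t κ c z n).2 := by positivity
    exact mul_ne_zero (mul_ne_zero (by linarith) ih) this.ne'

theorem fixed_den {z X : ℝ}
    (hX : X ^ 2 * (t * X - 1) = z * (κ - c * X)) :
    (t * X ^ 2 + c * z) * (κ - c * X) = X ^ 2 * (t * κ - c) := by
  linear_combination -c * hX

/-- Away from the critical values the even orbit of `1` converges to an attracting point of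
period at most two. -/
theorem exists_attracting (h : PottsParams t κ c) {z : ℝ} (hz : 0 < z)
    (hQ : 4 * t * c ^ 3 * z ^ 2 - ((t * κ) ^ 2 - 6 * (t * κ) * c - 3 * c ^ 2) * z + 4 * κ ≠ 0) :
    ∃ p p' : ℝ, 0 < p ∧ 0 < p' ∧ pottsStep t κ c z p = p' ∧ pottsStep t κ c z p' = p ∧
      Tendsto (fun n => pottsRatio t κ c z (2 * n)) atTop (𝓝 p) ∧
      4 * z ^ 2 * (t * κ - c) ^ 2 * (p * p') <
        ((t * p ^ 2 + c * z) * (t * p' ^ 2 + c * z)) ^ 2 := by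
  obtain ⟨p, hp0, hp, hpp⟩ := h.exists_tendsto_even hz
  have hp' : 0 < pottsStep t κ c z p :=
    (one_div_pos.2 h.t_pos).trans_le (h.step_mem hz p).1
  refine ⟨p, _, hp0, hp', rfl, hpp, hp, ?_⟩
  have hd := h.d_pos
  by_cases hpf : pottsStep t κ c z p = p
  · rw [hpf]
    have hX := (h.step_fixed_iff hz).1 hpf
    obtain ⟨hv, hu⟩ := h.fixed_pos hz hp0 hX
    have hden := fixed_den hX
    have hlim := h.tendsto_of_tendsto_even hz hpf hp
    have hquad := cycle_quadratic_at_fixed hX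
    have hR : 0 < 2 * t * c * p ^ 2 - (t * κ + 3 * c) * p + 2 * κ := by
      by_contra hR
      rcases (not_lt.1 hR).lt_or_eq with hR | hR
      · obtain ⟨n, hn⟩ := exists_pottsPair_eq_of_repelling hX
          (Eventually.of_forall fun n => (h.pair_pos hz n).2.ne') hlim (h.den_pos hz p).ne' (by
            rw [Real.norm_of_nonneg (h.den_pos hz p).le, Real.norm_eq_abs,
              abs_of_nonpos (by nlinarith)]
            refine lt_of_mul_lt_mul_right ?_ hu.le
            rw [hden]
            nlinarith)
        refine h.pair_sub_fixed_ne_zero hz hp0 hX ?_ n hn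
        rintro rfl
        have := h.base_pos
        linarith
      · apply hQ
        have hu2 : (κ - c * p) ^ 2 ≠ 0 := by positivity
        rw [hR, mul_zero] at hquad
        have he := (mul_eq_zero.1 hquad).resolve_right hu2
        have he' : (2 * (1 + t * c * z) * p - z * (t * κ - c)) * (κ - c * p) = 0 := by
          linear_combination p * (t * p + 1) * hR + ((t * κ - c) - 2 * t * c * p) * hX
        have he'' := (mul_eq_zero.1 he').resolve_right hu.ne'
        apply mul_left_cancel₀ hz.ne'
        linear_combination 4 * (1 + t * c * z) * he
          - (2 * (1 + t * c * z) * p - z * (t * κ - c)) * he''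
    have key : 2 * z * (t * κ - c) * p < (t * p ^ 2 + c * z) ^ 2 := by
      have hu2 : 0 < (κ - c * p) ^ 2 := by positivity
      refine lt_of_mul_lt_mul_right ?_ hu2.le
      have e1 : (t * p ^ 2 + c * z) ^ 2 * (κ - c * p) ^ 2 = p ^ 4 * (t * κ - c) ^ 2 := by
        rw [← mul_pow, hden]; ring
      have e2 : 2 * z * (t * κ - c) * p * (κ - c * p) ^ 2 =
          p ^ 3 * (t * κ - c) * (2 * (κ - c * p) * (t * p - 1)) := by
        linear_combination -2 * (t * κ - c) * p * (κ - c * p) * hX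
      rw [e1, e2]
      have e3 := mul_pos (mul_pos (pow_pos hp0 3) hd) hR
      nlinarith
    have h0 : 0 ≤ 2 * z * (t * κ - c) * p := by positivity
    calc 4 * z ^ 2 * (t * κ - c) ^ 2 * (p * p) = (2 * z * (t * κ - c) * p) ^ 2 := by ring
      _ < ((t * p ^ 2 + c * z) ^ 2) ^ 2 := pow_lt_pow_left₀ key h0 two_ne_zero
      _ = _ := by ring
  · set p' := pottsStep t κ c z p with hp'def
    obtain ⟨h1, h2, h3⟩ := h.cycle_sum_mul hz hp'def.symm hpp (Ne.symm hpf)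
    have hE : (t * p ^ 2 + c * z) * (t * p' ^ 2 + c * z) = z * (t * κ - c) * (p + p') := by
      rw [← h1]
      linear_combination (t * (p * p') + (p + p') + c * z - 2 * c * z) * h3
    rw [hE]
    have h4 : 0 < (p - p') ^ 2 := by
      have : p - p' ≠ 0 := sub_ne_zero.2 (Ne.symm hpf)
      positivity
    have h5 : 0 < (z * (t * κ - c)) ^ 2 * (p - p') ^ 2 := by positivity
    nlinarith

/-- At a critical value there is a fixed point with multiplier `-1`. -/
theorem exists_parabolic (h : PottsParams t κ c) {z : ℝ} (hz : 0 < z)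
    (hQ : 4 * t * c ^ 3 * z ^ 2 - ((t * κ) ^ 2 - 6 * (t * κ) * c - 3 * c ^ 2) * z + 4 * κ = 0) :
    ∃ X : ℝ, 0 < X ∧ X ^ 2 * (t * X - 1) = z * (κ - c * X) ∧
      2 * t * c * X ^ 2 - (t * κ + 3 * c) * X + 2 * κ = 0 := by
  have hd := h.d_pos
  have hτ : 0 < 1 + t * c * z := by
    have := mul_pos (mul_pos h.t_pos h.c_pos) hz
    linarith
  obtain ⟨X, hXdef⟩ : ∃ X, 2 * (1 + t * c * z) * X = z * (t * κ - c) :=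
    ⟨z * (t * κ - c) / (2 * (1 + t * c * z)), by field_simp⟩
  have hX0 : 0 < X := by
    have : 0 < 2 * (1 + t * c * z) * X := by rw [hXdef]; positivity
    exact (mul_pos_iff_of_pos_left (by positivity)).1 this
  have he : (1 + t * c * z) * X ^ 2 = z * (κ + c ^ 2 * z) := by
    apply mul_left_cancel₀ (mul_pos four_pos hτ).ne'
    linear_combination -z * hQ + (2 * (1 + t * c * z) * X + z * (t * κ - c)) * hXdef
  have h1 : t * X ^ 2 = 2 * X + c * z := by
    apply mul_left_cancel₀ hτ.ne'
    linear_combination t * he - hXdef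
  have h2 : X ^ 2 = κ * z - 2 * c * z * X := by
    apply mul_left_cancel₀ hτ.ne'
    linear_combination he + c * z * hXdef
  have hX : X ^ 2 * (t * X - 1) = z * (κ - c * X) := by
    linear_combination X * h1 + h2
  refine ⟨X, hX0, hX, ?_⟩
  have hquad := cycle_quadratic_at_fixed hX
  have h3 : (1 + t * c * z) * X ^ 2 - z * (t * κ - c) * X + z * (κ + c ^ 2 * z) = 0 := by
    linear_combination X * hXdef - he
  rw [h3, zero_mul] at hquad
  have : X ^ 3 * (t * κ - c) ≠ 0 := by positivity
  exact (mul_eq_zero.1 hquad.symm).resolve_left this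

end PottsParams

theorem tendsto_ofReal_nhdsNE (x₀ : ℝ) :
    Tendsto (fun x : ℝ => (x : ℂ)) (𝓝[≠] x₀) (𝓝[≠] (x₀ : ℂ)) := by
  refine tendsto_nhdsWithin_iff.2 ⟨(Complex.continuous_ofReal.tendsto x₀).mono_left
    nhdsWithin_le_nhds, ?_⟩
  filter_upwards [self_mem_nhdsWithin] with x hx
  simpa using hx

/-- If a sequence of sizes `N n` roughly squares at each step and is controlled by two
nonvanishing holomorphic functions, both comparable to their natural size on the real axis, then
`N n` is comparable to `‖F‖ ^ 2 ^ n` for a nonvanishing holomorphic function `F`. -/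
theorem exists_holomorphic_normalizer {x₀ r K : ℝ} (hr : 0 < r) (hK : 1 ≤ K)
    {N : ℕ → ℂ → ℝ} {L₁ L₂ : ℕ → ℂ → ℂ}
    (hN : ∀ n, ∀ z ∈ ball (x₀ : ℂ) r, 0 < N n z)
    (hN0 : ∀ z ∈ ball (x₀ : ℂ) r, N 0 z ≤ K)
    (hNle : ∀ n, ∀ z ∈ ball (x₀ : ℂ) r, N (n + 1) z ≤ K * N n z ^ 2)
    (hleN : ∀ n, ∀ z ∈ ball (x₀ : ℂ) r, N n z ^ 2 ≤ K * N (n + 1) z)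
    (hd₁ : ∀ n, DifferentiableOn ℂ (L₁ n) (ball (x₀ : ℂ) r))
    (hd₂ : ∀ n, DifferentiableOn ℂ (L₂ n) (ball (x₀ : ℂ) r))
    (h0₁ : ∀ n, ∀ z ∈ ball (x₀ : ℂ) r, L₁ n z ≠ 0)
    (h0₂ : ∀ n, ∀ z ∈ ball (x₀ : ℂ) r, L₂ n z ≠ 0)
    (hle₁ : ∀ n, ∀ z ∈ ball (x₀ : ℂ) r, ‖L₁ n z‖ ≤ K * N n z)
    (hle₂ : ∀ n, ∀ z ∈ ball (x₀ : ℂ) r, ‖L₂ n z‖ ≤ K * N n z ^ 2)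
    (hge : ∀ n, ∀ z ∈ ball (x₀ : ℂ) r, N n z ^ 2 ≤ K * max (‖L₁ n z‖ ^ 2) ‖L₂ n z‖)
    (hre₁ : ∀ n, ∀ x : ℝ, (x : ℂ) ∈ ball (x₀ : ℂ) r →
      ∃ y : ℝ, 0 < y ∧ L₁ n x = y ∧ N n x ≤ K * y)
    (hre₂ : ∀ n, ∀ x : ℝ, (x : ℂ) ∈ ball (x₀ : ℂ) r →
      ∃ y : ℝ, 0 < y ∧ L₂ n x = y ∧ N n x ^ 2 ≤ K * y) :
    ∃ (ρ : ℝ) (F : ℂ → ℂ), 0 < ρ ∧ ρ ≤ r ∧ DifferentiableOn ℂ F (ball (x₀ : ℂ) ρ) ∧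
      (∀ z ∈ ball (x₀ : ℂ) ρ, F z ≠ 0) ∧
      ∀ n, ∀ z ∈ ball (x₀ : ℂ) ρ,
        ‖F z‖ ^ 2 ^ n ≤ K * N n z ∧ N n z ≤ K * ‖F z‖ ^ 2 ^ n := by
  have hK0 : 0 < K := by linarith
  set k := Real.log K with hk
  have hk0 : 0 ≤ k := Real.log_nonneg hK
  set ℓ : ℕ → ℂ → ℝ := fun n z => Real.log (N n z) / 2 ^ n with hℓ
  have hp2 : ∀ n : ℕ, (0 : ℝ) < 2 ^ n := fun n => by positivity
  have hp2' : ∀ n : ℕ, (1 : ℝ) ≤ 2 ^ n := fun n => one_le_pow₀ (by norm_num)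
  have hkn : Tendsto (fun n : ℕ => k / 2 ^ n) atTop (𝓝 0) :=
    tendsto_const_nhds.div_atTop (tendsto_pow_atTop_atTop_of_one_lt (by norm_num))
  have hstep : ∀ z ∈ ball (x₀ : ℂ) r, ∀ n, dist (ℓ n z) (ℓ (n + 1) z) ≤ k / 2 / 2 ^ n := by
    intro z hz n
    have h1 := Real.log_le_log (hN (n + 1) z hz) (hNle n z hz)
    have h2 := Real.log_le_log (pow_pos (hN n z hz) 2) (hleN n z hz)
    rw [Real.log_mul hK0.ne' (pow_pos (hN n z hz) 2).ne', Real.log_pow] at h1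
    rw [Real.log_mul hK0.ne' (hN (n + 1) z hz).ne', Real.log_pow] at h2
    push_cast at h1 h2
    have h3 : ℓ n z - ℓ (n + 1) z =
        (2 * Real.log (N n z) - Real.log (N (n + 1) z)) / 2 / 2 ^ n := by
      simp only [hℓ, pow_succ]; field_simp
    rw [Real.dist_eq, h3, abs_div, abs_of_pos (hp2 n), abs_div, abs_of_pos (two_pos (α := ℝ))]
    gcongr
    rw [abs_le]; constructor <;> linarith
  have hlim : ∀ z, ∃ s, z ∈ ball (x₀ : ℂ) r → Tendsto (fun n => ℓ n z) atTop (𝓝 s) := by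
    intro z
    by_cases hz : z ∈ ball (x₀ : ℂ) r
    · obtain ⟨s, hs⟩ := cauchySeq_tendsto_of_complete (cauchySeq_of_le_geometric_two (hstep z hz))
      exact ⟨s, fun _ => hs⟩
    · exact ⟨0, fun h => absurd h hz⟩
  choose S hS using hlim
  have hℓS : ∀ z ∈ ball (x₀ : ℂ) r, ∀ n, |ℓ n z - S z| ≤ k / 2 ^ n := fun z hz n => by
    have := dist_le_of_le_geometric_two_of_tendsto (hstep z hz) (hS z hz) n
    rwa [Real.dist_eq] at this
  have hlogN : ∀ n z, Real.log (N n z) = ℓ n z * 2 ^ n := fun n z => by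
    simp only [hℓ]; field_simp
  have hℓ3 : ∀ z ∈ ball (x₀ : ℂ) r, ∀ n, ℓ n z ≤ 3 * k := by
    intro z hz n
    have h1 := abs_le.1 (hℓS z hz n)
    have h2 := abs_le.1 (hℓS z hz 0)
    have h3 : ℓ 0 z ≤ k := by
      simp only [hℓ, pow_zero, div_one]
      exact Real.log_le_log (hN 0 z hz) (hN0 z hz)
    have h4 : k / 2 ^ n ≤ k := div_le_self hk0 (hp2' n)
    simp only [pow_zero, div_one] at h2
    linarith [h1.2, h2.1]
  have hlogL₁ : ∀ n, ∀ z ∈ ball (x₀ : ℂ) r, Real.log ‖L₁ n z‖ / 2 ^ n ≤ k / 2 ^ n + ℓ n z := by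
    intro n z hz
    have h1 := Real.log_le_log (norm_pos_iff.2 (h0₁ n z hz)) (hle₁ n z hz)
    rw [Real.log_mul hK0.ne' (hN n z hz).ne'] at h1
    simp only [hℓ, ← add_div]
    gcongr
  have hlogL₂ : ∀ n, ∀ z ∈ ball (x₀ : ℂ) r,
      Real.log ‖L₂ n z‖ / 2 ^ n ≤ k / 2 ^ n + 2 * ℓ n z := by
    intro n z hz
    have h1 := Real.log_le_log (norm_pos_iff.2 (h0₂ n z hz)) (hle₂ n z hz)
    rw [Real.log_mul hK0.ne' (pow_pos (hN n z hz) 2).ne', Real.log_pow] at h1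
    push_cast at h1
    simp only [hℓ, mul_div_assoc', ← add_div]
    gcongr
  -- holomorphic roots of the two controlling functions
  have root : ∀ (L : ℕ → ℂ → ℂ), (∀ n, DifferentiableOn ℂ (L n) (ball (x₀ : ℂ) r)) →
      (∀ n, ∀ z ∈ ball (x₀ : ℂ) r, L n z ≠ 0) →
      (∀ n, ∀ x : ℝ, (x : ℂ) ∈ ball (x₀ : ℂ) r → ∃ y : ℝ, 0 < y ∧ L n x = y) →
      ∃ G : ℕ → ℂ → ℂ, (∀ n, DifferentiableOn ℂ (G n) (ball (x₀ : ℂ) r)) ∧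
        (∀ n, ∀ z ∈ ball (x₀ : ℂ) r, ‖G n z‖ = Real.exp (Real.log ‖L n z‖ / 2 ^ n)) ∧
        ∀ n, ∀ x : ℝ, (x : ℂ) ∈ ball (x₀ : ℂ) r →
          G n x = (Real.exp (Real.log ‖L n x‖ / 2 ^ n) : ℝ) := by
    intro L hd h0 hre
    choose g hgd hge hgi using fun n => exists_log_of_pos_on_real hr (hd n) (h0 n) (hre n)
    have hgre : ∀ n, ∀ z ∈ ball (x₀ : ℂ) r, (g n z).re = Real.log ‖L n z‖ := by
      intro n z hz
      rw [← hge n z hz, Complex.norm_exp, Real.log_exp]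
    have hre2 : ∀ n z, g n z / 2 ^ n = g n z / ((2 ^ n : ℝ) : ℂ) := fun n z => by push_cast; rfl
    refine ⟨fun n z => Complex.exp (g n z / 2 ^ n), fun n => ((hgd n).div_const _).cexp, ?_, ?_⟩
    · intro n z hz
      rw [Complex.norm_exp, hre2, Complex.div_ofReal_re, hgre n z hz]
    · intro n x hx
      have : g n x / 2 ^ n = ((Real.log ‖L n x‖ / 2 ^ n : ℝ) : ℂ) := by
        apply Complex.ext
        · rw [hre2, Complex.div_ofReal_re, hgre n x hx, Complex.ofReal_re]
        · rw [hre2, Complex.div_ofReal_im, hgi n x hx, Complex.ofReal_im, zero_div]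
      simp only [this, Complex.ofReal_exp]
  obtain ⟨G₁, hGd₁, hGn₁, hGr₁⟩ := root L₁ hd₁ h0₁ fun n x hx => by
    obtain ⟨y, h1, h2, -⟩ := hre₁ n x hx; exact ⟨y, h1, h2⟩
  obtain ⟨G₂, hGd₂, hGn₂, hGr₂⟩ := root L₂ hd₂ h0₂ fun n x hx => by
    obtain ⟨y, h1, h2, -⟩ := hre₂ n x hx; exact ⟨y, h1, h2⟩
  have hb₁ : ∀ n, ∀ z ∈ ball (x₀ : ℂ) r, ‖G₁ n z‖ ≤ Real.exp (4 * k) := by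
    intro n z hz
    rw [hGn₁ n z hz]
    apply Real.exp_le_exp.2
    have h4 : k / 2 ^ n ≤ k := div_le_self hk0 (hp2' n)
    linarith [hlogL₁ n z hz, hℓ3 z hz n]
  have hb₂ : ∀ n, ∀ z ∈ ball (x₀ : ℂ) r, ‖G₂ n z‖ ≤ Real.exp (7 * k) := by
    intro n z hz
    rw [hGn₂ n z hz]
    apply Real.exp_le_exp.2
    have h4 : k / 2 ^ n ≤ k := div_le_self hk0 (hp2' n)
    linarith [hlogL₂ n z hz, hℓ3 z hz n]
  have hlim₁ : ∀ x : ℝ, (x : ℂ) ∈ ball (x₀ : ℂ) r →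
      Tendsto (fun n => G₁ n x) atTop (𝓝 ((Real.exp (S x) : ℝ) : ℂ)) := by
    intro x hx
    have h1 : Tendsto (fun n => Real.log ‖L₁ n x‖ / 2 ^ n) atTop (𝓝 (S x)) := by
      refine tendsto_of_tendsto_of_tendsto_of_le_of_le (g := fun n => ℓ n x - k / 2 ^ n)
        (h := fun n => k / 2 ^ n + ℓ n x) ?_ ?_ (fun n => ?_) (fun n => hlogL₁ n x hx)
      · simpa using (hS x hx).sub hkn
      · simpa using hkn.add (hS x hx)
      · obtain ⟨y, hy, hLy, hNy⟩ := hre₁ n x hx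
        have h2 := Real.log_le_log (hN n x hx) hNy
        rw [Real.log_mul hK0.ne' hy.ne'] at h2
        simp only [hℓ, ← sub_div, hLy, Complex.norm_real, Real.norm_of_nonneg hy.le]
        gcongr
        linarith
    refine (((Complex.continuous_ofReal.comp Real.continuous_exp).tendsto _).comp h1).congr ?_
    intro n
    rw [hGr₁ n x hx]; rfl
  have hlim₂ : ∀ x : ℝ, (x : ℂ) ∈ ball (x₀ : ℂ) r →
      Tendsto (fun n => G₂ n x) atTop (𝓝 ((Real.exp (2 * S x) : ℝ) : ℂ)) := by
    intro x hx
    have h1 : Tendsto (fun n => Real.log ‖L₂ n x‖ / 2 ^ n) atTop (𝓝 (2 * S x)) := by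
      refine tendsto_of_tendsto_of_tendsto_of_le_of_le (g := fun n => 2 * ℓ n x - k / 2 ^ n)
        (h := fun n => k / 2 ^ n + 2 * ℓ n x) ?_ ?_ (fun n => ?_) (fun n => hlogL₂ n x hx)
      · simpa using ((hS x hx).const_mul 2).sub hkn
      · simpa using hkn.add ((hS x hx).const_mul 2)
      · obtain ⟨y, hy, hLy, hNy⟩ := hre₂ n x hx
        have h2 := Real.log_le_log (pow_pos (hN n x hx) 2) hNy
        rw [Real.log_mul hK0.ne' hy.ne', Real.log_pow] at h2
        push_cast at h2
        simp only [hℓ, mul_div_assoc', ← sub_div, hLy, Complex.norm_real,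
          Real.norm_of_nonneg hy.le]
        gcongr
        linarith
    refine (((Complex.continuous_ofReal.comp Real.continuous_exp).tendsto _).comp h1).congr ?_
    intro n
    rw [hGr₂ n x hx]; rfl
  have hnear : ∀ s > 0, ∀ᶠ x : ℝ in 𝓝[≠] x₀, (x : ℂ) ∈ ball (x₀ : ℂ) s := fun s hs =>
    (tendsto_ofReal_nhdsNE x₀).eventually (mem_nhdsWithin_of_mem_nhds (ball_mem_nhds _ hs))
  obtain ⟨F, hFd, hF⟩ := exists_differentiableOn_tendsto_of_frequently hr hGd₁ hb₁
    (g := fun z => (Real.exp (S z) : ℝ))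
    ((tendsto_ofReal_nhdsNE x₀).frequently ((hnear r hr).mono fun x hx => hlim₁ x hx).frequently)
  obtain ⟨F', hFd', hF'⟩ := exists_differentiableOn_tendsto_of_frequently hr hGd₂ hb₂
    (g := fun z => (Real.exp (2 * S z) : ℝ))
    ((tendsto_ofReal_nhdsNE x₀).frequently ((hnear r hr).mono fun x hx => hlim₂ x hx).frequently)
  have hr4 : 0 < r / 4 := by positivity
  have hsub : ball (x₀ : ℂ) (r / 4) ⊆ ball (x₀ : ℂ) r := ball_subset_ball (by linarith)
  have hc4 : (x₀ : ℂ) ∈ ball (x₀ : ℂ) (r / 4) := mem_ball_self hr4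
  have hFx : ∀ x : ℝ, (x : ℂ) ∈ ball (x₀ : ℂ) (r / 4) → F x = (Real.exp (S x) : ℝ) :=
    fun x hx => tendsto_nhds_unique (hF x hx) (hlim₁ x (hsub hx))
  have hFx' : ∀ x : ℝ, (x : ℂ) ∈ ball (x₀ : ℂ) (r / 4) → F' x = (Real.exp (2 * S x) : ℝ) :=
    fun x hx => tendsto_nhds_unique (hF' x hx) (hlim₂ x (hsub hx))
  have hsq : EqOn F' (fun z => F z ^ 2) (ball (x₀ : ℂ) (r / 4)) := by
    refine (hFd'.analyticOnNhd isOpen_ball).eqOn_of_preconnected_of_frequently_eq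
      ((hFd.pow 2).analyticOnNhd isOpen_ball) (convex_ball _ _).isPreconnected hc4 ?_
    refine (tendsto_ofReal_nhdsNE x₀).frequently
      ((hnear _ hr4).mono fun x hx => ?_).frequently
    rw [hFx x hx, hFx' x hx, two_mul, Real.exp_add]
    push_cast; ring
  have hFc : F x₀ ≠ 0 := by
    rw [hFx x₀ hc4]
    exact_mod_cast (Real.exp_pos _).ne'
  have hcont : ContinuousAt F (x₀ : ℂ) :=
    (hFd.differentiableAt (isOpen_ball.mem_nhds hc4)).continuousAt
  obtain ⟨s, hs, hs0⟩ := Metric.eventually_nhds_iff_ball.1 (hcont.eventually_ne hFc)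
  have hsub' : ball (x₀ : ℂ) (min s (r / 4)) ⊆ ball (x₀ : ℂ) (r / 4) :=
    ball_subset_ball (min_le_right _ _)
  refine ⟨min s (r / 4), F, lt_min hs hr4, (min_le_right _ _).trans (by linarith),
    hFd.mono hsub', fun z hz => hs0 z (ball_subset_ball (min_le_left _ _) hz), ?_⟩
  have hSF : ∀ z ∈ ball (x₀ : ℂ) (min s (r / 4)), S z = Real.log ‖F z‖ := by
    intro z hz
    have hz0 : F z ≠ 0 := hs0 z (ball_subset_ball (min_le_left _ _) hz)
    have hz4 := hsub' hz
    have hzr := hsub hz4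
    have e1 : Tendsto (fun n => Real.log ‖L₁ n z‖ / 2 ^ n) atTop (𝓝 (Real.log ‖F z‖)) := by
      refine ((hF z hz4).norm.log (norm_ne_zero_iff.2 hz0)).congr fun n => ?_
      rw [hGn₁ n z hzr, Real.log_exp]
    have e2 : Tendsto (fun n => Real.log ‖L₂ n z‖ / 2 ^ n) atTop (𝓝 (2 * Real.log ‖F z‖)) := by
      have hz0' : F' z ≠ 0 := by rw [hsq hz4]; exact pow_ne_zero 2 hz0
      have := (hF' z hz4).norm.log (norm_ne_zero_iff.2 hz0')
      rw [hsq hz4] at this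
      simp only [norm_pow, Real.log_pow] at this
      push_cast at this
      refine this.congr fun n => ?_
      rw [hGn₂ n z hzr, Real.log_exp]
    apply le_antisymm
    · have h2 : Tendsto (fun n => k / 2 ^ n +
          max (2 * (Real.log ‖L₁ n z‖ / 2 ^ n)) (Real.log ‖L₂ n z‖ / 2 ^ n)) atTop
          (𝓝 (0 + max (2 * Real.log ‖F z‖) (2 * Real.log ‖F z‖))) :=
        hkn.add ((e1.const_mul 2).max e2)
      have h3 := le_of_tendsto_of_tendsto' ((hS z hzr).const_mul 2) h2 fun n => by
        have h1₁ := norm_pos_iff.2 (h0₁ n z hzr)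
        have h1₂ := norm_pos_iff.2 (h0₂ n z hzr)
        have h5 : 2 * Real.log (N n z) ≤
            k + max (2 * Real.log ‖L₁ n z‖) (Real.log ‖L₂ n z‖) := by
          have h4 := Real.log_le_log (pow_pos (hN n z hzr) 2) (hge n z hzr)
          rw [Real.log_mul hK0.ne' (lt_max_of_lt_right h1₂).ne', Real.log_pow] at h4
          push_cast at h4
          refine h4.trans (add_le_add le_rfl ?_)
          rcases max_choice (‖L₁ n z‖ ^ 2) ‖L₂ n z‖ with h6 | h6 <;> rw [h6]
          · rw [Real.log_pow]; push_cast; exact le_max_left _ _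
          · exact le_max_right _ _
        have h7 : max (2 * (Real.log ‖L₁ n z‖ / 2 ^ n)) (Real.log ‖L₂ n z‖ / 2 ^ n) =
            max (2 * Real.log ‖L₁ n z‖) (Real.log ‖L₂ n z‖) / 2 ^ n := by
          rw [mul_div_assoc', max_div_div_right (hp2 n).le]
        rw [h7, ← add_div]
        simp only [hℓ]
        rw [mul_div_assoc']
        gcongr
      rw [max_self, zero_add] at h3
      linarith
    · have h2 := hkn.add (hS z hzr)
      rw [zero_add] at h2
      exact le_of_tendsto_of_tendsto' e1 h2 fun n => hlogL₁ n z hzr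
  intro n z hz
  have hz0 : 0 < ‖F z‖ := norm_pos_iff.2 (hs0 z (ball_subset_ball (min_le_left _ _) hz))
  have hzr := hsub (hsub' hz)
  have h1 := abs_le.1 (hℓS z hzr n)
  rw [hSF z hz, le_div_iff₀ (hp2 n), ← neg_div, div_le_iff₀ (hp2 n), sub_mul, ← hlogN] at h1
  have h2 : Real.log (‖F z‖ ^ 2 ^ n) = Real.log ‖F z‖ * 2 ^ n := by
    rw [Real.log_pow]; push_cast; ring
  constructor
  · rw [← Real.log_le_log_iff (by positivity) (mul_pos hK0 (hN n z hzr)),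
      Real.log_mul hK0.ne' (hN n z hzr).ne', h2]
    linarith [h1.1]
  · rw [← Real.log_le_log_iff (hN n z hzr) (by positivity),
      Real.log_mul hK0.ne' (by positivity), h2]
    linarith [h1.2]

theorem differentiable_pottsPair (t κ c : ℂ) (n : ℕ) :
    Differentiable ℂ (fun z => (pottsPair t κ c z n).1) ∧
      Differentiable ℂ (fun z => (pottsPair t κ c z n).2) := by
  induction n with
  | zero => simp [pottsPair]
  | succ n ih =>
    obtain ⟨h1, h2⟩ := ih
    simp only [pottsPair]
    constructor <;> fun_prop

theorem pottsPair_succ_snd {K : Type*} [Field K] {t κ c z : K} {n : ℕ}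
    (h : (pottsPair t κ c z n).2 ≠ 0) :
    (pottsPair t κ c z (n + 1)).2 =
      (pottsPair t κ c z n).2 ^ 2 * (t * pottsRatio t κ c z n ^ 2 + c * z) := by
  simp only [pottsPair, pottsRatio]
  field_simp

theorem hasDerivAt_pottsStep {t κ c z w : ℂ} (hw : t * w ^ 2 + c * z ≠ 0) :
    HasDerivAt (pottsStep t κ c z) (-(2 * w * z * (t * κ - c)) / (t * w ^ 2 + c * z) ^ 2) w := by
  have h1 : HasDerivAt (fun w => w ^ 2 + κ * z) (2 * w) w := by
    simpa using (hasDerivAt_pow 2 w).add_const (κ * z)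
  have h2 : HasDerivAt (fun w => t * w ^ 2 + c * z) (t * (2 * w)) w := by
    simpa using ((hasDerivAt_pow 2 w).const_mul t).add_const (c * z)
  refine (h1.div h2 hw).congr_deriv ?_
  congr 1
  ring

/-- A differentiable map with multiplier less than one in norm shrinks small discs around its
fixed point. -/
theorem eventually_mapsTo_ball_of_hasDerivAt {f : ℂ → ℂ} {μ p : ℂ} (hf : HasDerivAt f μ p)
    (hfp : f p = p) (hμ : ‖μ‖ < 1) :
    ∀ᶠ ε in 𝓝[>] (0 : ℝ), ∀ w ∈ closedBall p ε, f w ∈ ball p ε := by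
  have h1 := hf.isLittleO.def (sub_pos.2 hμ |> half_pos)
  obtain ⟨δ, hδ, h2⟩ := Metric.eventually_nhds_iff_ball.1 h1
  filter_upwards [Ioo_mem_nhdsGT hδ] with ε hε w hw
  have h3 := h2 w (closedBall_subset_ball hε.2 hw)
  rw [mem_closedBall, dist_eq_norm] at hw
  rw [mem_ball, dist_eq_norm]
  rw [hfp, smul_eq_mul] at h3
  have h4 : f w - p = (f w - p - (w - p) * μ) + (w - p) * μ := by ring
  have h5 : ‖f w - p‖ ≤ (1 - ‖μ‖) / 2 * ‖w - p‖ + ‖w - p‖ * ‖μ‖ := by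
    conv_lhs => rw [h4]
    refine (norm_add_le _ _).trans ?_
    rw [norm_mul]
    gcongr
  have h6 : ((1 - ‖μ‖) / 2 + ‖μ‖) * ‖w - p‖ ≤ ((1 - ‖μ‖) / 2 + ‖μ‖) * ε := by
    have := norm_nonneg μ
    gcongr
  nlinarith [hε.1]

namespace PottsParams

variable {t κ c : ℝ}

/-- Near a noncritical positive real number the partition functions have no zeros. -/
theorem eventually_forall_ne_zero (h : PottsParams t κ c) {z₀ m : ℝ} (hz₀ : 0 < z₀) (hm : 0 < m)
    (hQ : 4 * t * c ^ 3 * z₀ ^ 2 - ((t * κ) ^ 2 - 6 * (t * κ) * c - 3 * c ^ 2) * z₀ + 4 * κ ≠ 0) :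
    ∀ᶠ z in 𝓝 (z₀ : ℂ), ∀ n, (pottsPair (t : ℂ) κ c z n).1 ^ 3 +
      m * z * (pottsPair (t : ℂ) κ c z n).2 ^ 3 ≠ 0 := by
  obtain ⟨p, p', hp0, hp'0, hpp', hp'p, hlim, hμ⟩ := h.exists_attracting hz₀ hQ
  set S : ℂ → ℂ → ℂ := pottsStep (t : ℂ) κ c with hS
  have hcast : ∀ x : ℝ, S z₀ x = ((pottsStep t κ c z₀ x : ℝ) : ℂ) := fun x => by
    simp [hS, pottsStep]
  have hSp : S z₀ p = p' := by rw [hcast, hpp']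
  have hSp' : S z₀ p' = p := by rw [hcast, hp'p]
  have hden : ∀ x : ℝ, (t : ℂ) * (x : ℂ) ^ 2 + c * z₀ ≠ 0 := fun x => by
    exact_mod_cast (h.den_pos hz₀ x).ne'
  have hcube : ∀ x : ℝ, 0 < x → (x : ℂ) ^ 3 + m * z₀ ≠ 0 := fun x hx => by
    have : 0 < x ^ 3 + m * z₀ := by positivity
    exact_mod_cast this.ne'
  have hScont : ∀ {z w : ℂ}, (t : ℂ) * w ^ 2 + c * z ≠ 0 →
      ContinuousAt (fun x : ℂ × ℂ => S x.1 x.2) (z, w) := by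
    intro z w hw
    simp only [hS, pottsStep]
    exact ContinuousAt.div (by fun_prop) (by fun_prop) hw
  have hgood : ∀ᶠ x : ℂ × ℂ in 𝓝 ((z₀ : ℂ), (p : ℂ)),
      (t : ℂ) * x.2 ^ 2 + c * x.1 ≠ 0 ∧ (t : ℂ) * S x.1 x.2 ^ 2 + c * x.1 ≠ 0 ∧
      x.2 ^ 3 + m * x.1 ≠ 0 ∧ S x.1 x.2 ^ 3 + m * x.1 ≠ 0 := by
    have hc := hScont (hden p)
    refine Eventually.and ?_ (Eventually.and ?_ (Eventually.and ?_ ?_))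
    · exact ContinuousAt.eventually_ne (by fun_prop) (hden p)
    · refine ContinuousAt.eventually_ne (g := fun x : ℂ × ℂ => (t : ℂ) * S x.1 x.2 ^ 2 + c * x.1)
        (by fun_prop) ?_
      simpa only [hSp] using hden p'
    · exact ContinuousAt.eventually_ne (by fun_prop) (hcube p hp0)
    · refine ContinuousAt.eventually_ne (g := fun x : ℂ × ℂ => S x.1 x.2 ^ 3 + m * x.1)
        (by fun_prop) ?_
      simpa only [hSp] using hcube p' hp'0
  obtain ⟨δ, hδ, hgood⟩ := Metric.eventually_nhds_iff_ball.1 hgood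
  have hderiv := (hSp ▸ hasDerivAt_pottsStep (κ := (κ : ℂ)) (hden p') :
    HasDerivAt (S z₀) _ (S z₀ p)).comp (p : ℂ) (hasDerivAt_pottsStep (hden p))
  have hshrink := eventually_mapsTo_ball_of_hasDerivAt hderiv (by simp [hSp, hSp']) (by
    rw [hSp]
    have e : (-(2 * (p' : ℂ) * z₀ * (t * κ - c)) / (t * (p' : ℂ) ^ 2 + c * z₀) ^ 2 *
        (-(2 * (p : ℂ) * z₀ * (t * κ - c)) / (t * (p : ℂ) ^ 2 + c * z₀) ^ 2)) =
        ((4 * z₀ ^ 2 * (t * κ - c) ^ 2 * (p * p') /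
          ((t * p ^ 2 + c * z₀) * (t * p' ^ 2 + c * z₀)) ^ 2 : ℝ) : ℂ) := by
      push_cast
      rw [div_mul_div_comm]
      congr 1 <;> ring
    rw [e, Complex.norm_real, Real.norm_of_nonneg (by positivity)]
    rw [div_lt_one]
    · exact hμ
    · exact pow_pos (mul_pos (h.den_pos hz₀ _) (h.den_pos hz₀ _)) 2)
  obtain ⟨ε, hεmap, hε0, hεδ⟩ := (hshrink.and (Ioo_mem_nhdsGT hδ)).exists
  have hgood' : ∀ z ∈ ball (z₀ : ℂ) δ, ∀ w ∈ closedBall (p : ℂ) ε,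
      (t : ℂ) * w ^ 2 + c * z ≠ 0 ∧ (t : ℂ) * S z w ^ 2 + c * z ≠ 0 ∧
      w ^ 3 + m * z ≠ 0 ∧ S z w ^ 3 + m * z ≠ 0 := fun z hz w hw =>
    hgood (z, w) (by
      rw [← ball_prod_same]
      exact ⟨hz, closedBall_subset_ball hεδ hw⟩)
  have hunif : ∀ᶠ z in 𝓝 (z₀ : ℂ), ∀ w ∈ closedBall (p : ℂ) ε, S z (S z w) ∈ ball (p : ℂ) ε := by
    refine (isCompact_closedBall (p : ℂ) ε).eventually_forall_of_forall_eventually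
      (P := fun z w => S z (S z w) ∈ ball (p : ℂ) ε) fun w hw => ?_
    obtain ⟨h1, h2, -, -⟩ := hgood' z₀ (mem_ball_self hδ) w hw
    have hc : ContinuousAt (fun x : ℂ × ℂ => (x.1, S x.1 x.2)) ((z₀ : ℂ), w) :=
      continuousAt_fst.prodMk (hScont h1)
    have hc2 : ContinuousAt (fun x : ℂ × ℂ => S x.1 (S x.1 x.2)) ((z₀ : ℂ), w) :=
      ContinuousAt.comp (f := fun x : ℂ × ℂ => (x.1, S x.1 x.2))
        (g := fun x : ℂ × ℂ => S x.1 x.2) (hScont h2) hc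
    exact hc2.eventually_mem (isOpen_ball.mem_nhds (hεmap w hw))
  obtain ⟨N, hN⟩ := (hlim.eventually_mem (ball_mem_nhds p hε0)).exists
  have hcA : ∀ n, Continuous fun z : ℂ => (pottsPair (t : ℂ) κ c z n).1 := fun n =>
    (differentiable_pottsPair _ _ _ n).1.continuous
  have hcB : ∀ n, Continuous fun z : ℂ => (pottsPair (t : ℂ) κ c z n).2 := fun n =>
    (differentiable_pottsPair _ _ _ n).2.continuous
  have hB0 : (pottsPair (t : ℂ) κ c z₀ (2 * N)).2 ≠ 0 := by
    rw [pottsPair_ofReal]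
    exact Complex.ofReal_ne_zero.2 (h.pair_pos hz₀ _).2.ne'
  have hstart : ∀ᶠ z in 𝓝 (z₀ : ℂ), pottsRatio (t : ℂ) κ c z (2 * N) ∈ closedBall (p : ℂ) ε := by
    have hc : ContinuousAt (fun z : ℂ => pottsRatio (t : ℂ) κ c z (2 * N)) z₀ :=
      ContinuousAt.div (hcA _).continuousAt (hcB _).continuousAt hB0
    refine hc.eventually_mem (closedBall_mem_nhds_of_mem ?_)
    rw [pottsRatio_ofReal, mem_ball, Complex.dist_of_im_eq (by simp)]
    simpa using hN
  have hfin : ∀ᶠ z in 𝓝 (z₀ : ℂ), ∀ n ∈ Finset.range (2 * N),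
      (pottsPair (t : ℂ) κ c z n).1 ^ 3 + m * z * (pottsPair (t : ℂ) κ c z n).2 ^ 3 ≠ 0 := by
    rw [Finset.eventually_all]
    intro n _
    refine ContinuousAt.eventually_ne (g := fun z : ℂ => (pottsPair (t : ℂ) κ c z n).1 ^ 3 +
      m * z * (pottsPair (t : ℂ) κ c z n).2 ^ 3) ?_ ?_
    · have := hcA n
      have := hcB n
      fun_prop
    · rw [pottsPair_ofReal]
      obtain ⟨h1, h2⟩ := h.pair_pos hz₀ n
      have : 0 < (pottsPair t κ c z₀ n).1 ^ 3 + m * z₀ * (pottsPair t κ c z₀ n).2 ^ 3 := by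
        positivity
      dsimp only
      exact_mod_cast this.ne'
  filter_upwards [hunif, hstart, hfin, (hcB (2 * N)).continuousAt.eventually_ne hB0,
    ball_mem_nhds (z₀ : ℂ) hδ] with z hu hs hf hb hz
  have hE : ∀ n, (pottsPair (t : ℂ) κ c z n).2 ≠ 0 → pottsRatio (t : ℂ) κ c z n ^ 3 + m * z ≠ 0 →
      (pottsPair (t : ℂ) κ c z n).1 ^ 3 + m * z * (pottsPair (t : ℂ) κ c z n).2 ^ 3 ≠ 0 := by
    intro n h1 h2
    have : (pottsPair (t : ℂ) κ c z n).1 ^ 3 + m * z * (pottsPair (t : ℂ) κ c z n).2 ^ 3 =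
        (pottsPair (t : ℂ) κ c z n).2 ^ 3 * (pottsRatio (t : ℂ) κ c z n ^ 3 + m * z) := by
      simp only [pottsRatio]; field_simp
    rw [this]
    exact mul_ne_zero (pow_ne_zero _ h1) h2
  have hB1 : ∀ n, (pottsPair (t : ℂ) κ c z n).2 ≠ 0 →
      (t : ℂ) * pottsRatio (t : ℂ) κ c z n ^ 2 + c * z ≠ 0 →
      (pottsPair (t : ℂ) κ c z (n + 1)).2 ≠ 0 := fun n h1 h2 => by
    rw [pottsPair_succ_snd h1]
    exact mul_ne_zero (pow_ne_zero _ h1) h2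
  have hind : ∀ k, (pottsPair (t : ℂ) κ c z (2 * (N + k))).2 ≠ 0 ∧
      pottsRatio (t : ℂ) κ c z (2 * (N + k)) ∈ closedBall (p : ℂ) ε := by
    intro k
    induction k with
    | zero => exact ⟨hb, hs⟩
    | succ k ih =>
      obtain ⟨h1, h2⟩ := ih
      obtain ⟨g1, g2, -, -⟩ := hgood' z hz _ h2
      have h3 := hB1 _ h1 g1
      have e3 := pottsRatio_succ h1
      have g3 : (t : ℂ) * pottsRatio (t : ℂ) κ c z (2 * (N + k) + 1) ^ 2 + c * z ≠ 0 := by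
        rw [e3]; exact g2
      rw [show 2 * (N + (k + 1)) = 2 * (N + k) + 1 + 1 by ring]
      refine ⟨hB1 _ h3 g3, ?_⟩
      rw [pottsRatio_succ h3, e3]
      exact ball_subset_closedBall (hu _ h2)
  intro n
  rcases lt_or_ge n (2 * N) with hn | hn
  · exact hf n (Finset.mem_range.2 hn)
  · obtain ⟨j, hj⟩ := Nat.even_or_odd' n
    obtain ⟨k, rfl⟩ : ∃ k, j = N + k := ⟨j - N, by omega⟩
    obtain ⟨h1, h2⟩ := hind k
    obtain ⟨g1, g2, g3, g4⟩ := hgood' z hz _ h2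
    rcases hj with rfl | rfl
    · exact hE _ h1 g3
    · refine hE _ (hB1 _ h1 g1) ?_
      rw [pottsRatio_succ h1]
      exact g4

end PottsParams

theorem le_one_add_pow_three {x : ℝ} (hx : 0 ≤ x) : x ≤ 1 + x ^ 3 := by
  nlinarith [sq_nonneg (x - 1), mul_nonneg hx (sq_nonneg (x - 1)), pow_nonneg hx 3]

/-- A quadratic form lower bound for the two factors of `a ^ 3 + (β * b) ^ 3`. -/
theorem sq_norm_le_max_factors (a v : ℂ) :
    ‖v‖ ^ 2 ≤ 3 * max (‖a + v‖ ^ 2) ‖a ^ 2 - a * v + v ^ 2‖ ∧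
      ‖a‖ ^ 2 ≤ 8 * max (‖a + v‖ ^ 2) ‖a ^ 2 - a * v + v ^ 2‖ := by
  set μ := max (‖a + v‖ ^ 2) ‖a ^ 2 - a * v + v ^ 2‖
  have h1 : ‖a + v‖ ^ 2 ≤ μ := le_max_left _ _
  have h2 : ‖a ^ 2 - a * v + v ^ 2‖ ≤ μ := le_max_right _ _
  have hv : ‖v‖ ^ 2 ≤ 3 * μ := by
    have e : 3 * v ^ 2 = (a ^ 2 - a * v + v ^ 2) - (a + v) ^ 2 + 3 * (v * (a + v)) := by ring
    have h3 : 3 * ‖v‖ ^ 2 ≤ ‖a ^ 2 - a * v + v ^ 2‖ + ‖a + v‖ ^ 2 + 3 * (‖v‖ * ‖a + v‖) := by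
      have := congrArg norm e
      simp only [norm_mul, norm_pow] at this
      norm_num at this
      rw [this]
      refine (norm_add_le _ _).trans (add_le_add ((norm_sub_le _ _).trans ?_) ?_)
      · simp
      · simp
    nlinarith [sq_nonneg (‖v‖ - ‖a + v‖)]
  refine ⟨hv, ?_⟩
  have h4 : ‖a‖ ≤ ‖a + v‖ + ‖v‖ := by
    calc ‖a‖ = ‖(a + v) - v‖ := by simp
      _ ≤ _ := norm_sub_le _ _
  have h5 : ‖a‖ ^ 2 ≤ (‖a + v‖ + ‖v‖) ^ 2 := pow_le_pow_left₀ (norm_nonneg _) h4 2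
  nlinarith [sq_nonneg (‖v‖ - ‖a + v‖)]

namespace PottsParams

variable {t κ c : ℝ}

/-- If the partition functions have no zeros along a holomorphic curve of parameters through the
positive axis, then the growth of the orbit is governed by a holomorphic function. -/
theorem exists_pair_normalizer (h : PottsParams t κ c) {x₀ r m M : ℝ} (hr : 0 < r) (hm : 0 < m)
    {ζ : ℂ → ℂ} (hζ : DifferentiableOn ℂ ζ (ball (x₀ : ℂ) r))
    (hslit : ∀ X ∈ ball (x₀ : ℂ) r, m * ζ X ∈ Complex.slitPlane)
    (hreal : ∀ x : ℝ, (x : ℂ) ∈ ball (x₀ : ℂ) r → ∃ y : ℝ, 0 < y ∧ ζ x = y)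
    (hM : ∀ X ∈ ball (x₀ : ℂ) r, ‖ζ X‖ ≤ M) (hM' : ∀ X ∈ ball (x₀ : ℂ) r, ‖(ζ X)⁻¹‖ ≤ M)
    (hE : ∀ X ∈ ball (x₀ : ℂ) r, ∀ n, (pottsPair (t : ℂ) κ c (ζ X) n).1 ^ 3 +
      m * ζ X * (pottsPair (t : ℂ) κ c (ζ X) n).2 ^ 3 ≠ 0) :
    ∃ (K ρ : ℝ) (F : ℂ → ℂ), 0 < K ∧ 0 < ρ ∧ ρ ≤ r ∧ DifferentiableOn ℂ F (ball (x₀ : ℂ) ρ) ∧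
      (∀ z ∈ ball (x₀ : ℂ) ρ, F z ≠ 0) ∧
      ∀ n, ∀ X ∈ ball (x₀ : ℂ) ρ, ‖F X‖ ^ 2 ^ n ≤ K * ‖pottsPair (t : ℂ) κ c (ζ X) n‖ ∧
        ‖pottsPair (t : ℂ) κ c (ζ X) n‖ ≤ K * ‖F X‖ ^ 2 ^ n := by
  have ht := h.t_pos
  have hκ := h.κ_pos
  have hc := h.c_pos
  have hd := h.d_pos
  set β : ℂ → ℂ := fun X => (m * ζ X) ^ ((3 : ℂ)⁻¹) with hβ
  have hβ3 : ∀ X, β X ^ 3 = m * ζ X := fun X => by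
    have := Complex.cpow_nat_inv_pow (m * ζ X) (n := 3) (by norm_num)
    exact_mod_cast this
  have hβd : DifferentiableOn ℂ β (ball (x₀ : ℂ) r) :=
    (hζ.const_mul (m : ℂ)).cpow_const hslit
  have hβre : ∀ x : ℝ, (x : ℂ) ∈ ball (x₀ : ℂ) r → ∃ y : ℝ, 0 < y ∧ β x = y := by
    intro x hx
    obtain ⟨y, hy, e⟩ := hreal x hx
    refine ⟨(m * y) ^ ((3 : ℝ)⁻¹), by positivity, ?_⟩
    rw [hβ, Complex.ofReal_cpow (by positivity)]
    simp [e]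
  have hζ0 : ∀ X ∈ ball (x₀ : ℂ) r, ζ X ≠ 0 := fun X hX h0 => by
    have := hslit X hX
    simp [h0] at this
  have hβ0 : ∀ X ∈ ball (x₀ : ℂ) r, β X ≠ 0 := fun X hX h0 => by
    have := hβ3 X
    rw [h0] at this
    have h1 := mul_ne_zero (Complex.ofReal_ne_zero.2 hm.ne') (hζ0 X hX)
    exact h1 (by rw [← this]; simp)
  have hM0 : 0 ≤ M := (norm_nonneg _).trans (hM x₀ (mem_ball_self hr))
  have hβM : ∀ X ∈ ball (x₀ : ℂ) r, ‖β X‖ ≤ 1 + m * M := by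
    intro X hX
    have h1 := congrArg norm (hβ3 X)
    rw [norm_pow, norm_mul, Complex.norm_real, Real.norm_of_nonneg hm.le] at h1
    refine (le_one_add_pow_three (norm_nonneg _)).trans ?_
    rw [h1]
    gcongr
    exact hM X hX
  have hβM' : ∀ X ∈ ball (x₀ : ℂ) r, ‖(β X)⁻¹‖ ≤ 1 + m⁻¹ * M := by
    intro X hX
    have h1 := congrArg norm (congrArg Inv.inv (hβ3 X))
    rw [← inv_pow, norm_pow, mul_inv, norm_mul, norm_inv (m : ℂ), Complex.norm_real,
      Real.norm_of_nonneg hm.le] at h1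
    refine (le_one_add_pow_three (norm_nonneg _)).trans ?_
    rw [h1]
    gcongr
    exact hM' X hX
  obtain ⟨k, hk1, hkζ, hkζ', hkβ, hkβ', hkt, hkκ, hkc, hkd⟩ : ∃ k : ℝ, 1 ≤ k ∧
      (∀ X ∈ ball (x₀ : ℂ) r, ‖ζ X‖ ≤ k) ∧ (∀ X ∈ ball (x₀ : ℂ) r, ‖(ζ X)⁻¹‖ ≤ k) ∧
      (∀ X ∈ ball (x₀ : ℂ) r, ‖β X‖ ≤ k) ∧ (∀ X ∈ ball (x₀ : ℂ) r, ‖(β X)⁻¹‖ ≤ k) ∧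
      t ≤ k ∧ κ ≤ k ∧ c ≤ k ∧ (t * κ - c)⁻¹ ≤ k := by
    have h1 : 0 ≤ m * M := by positivity
    have h2 : 0 ≤ m⁻¹ * M := by positivity
    have h3 : 0 < (t * κ - c)⁻¹ := by positivity
    refine ⟨1 + M + m * M + m⁻¹ * M + t + κ + c + (t * κ - c)⁻¹, by linarith,
      fun X hX => ?_, fun X hX => ?_, fun X hX => ?_, fun X hX => ?_,
      by linarith, by linarith, by linarith, by linarith⟩
    · linarith [hM X hX]
    · linarith [hM' X hX]
    · linarith [hβM X hX]
    · linarith [hβM' X hX]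
  have hk0 : 0 < k := by linarith
  have hk2 : k ≤ k ^ 2 := by nlinarith
  have hk3 : k ^ 2 ≤ k ^ 3 := by nlinarith [sq_nonneg k]
  set A : ℕ → ℂ → ℂ := fun n X => (pottsPair (t : ℂ) κ c (ζ X) n).1 with hA
  set B : ℕ → ℂ → ℂ := fun n X => (pottsPair (t : ℂ) κ c (ζ X) n).2 with hB
  have hAd : ∀ n, DifferentiableOn ℂ (A n) (ball (x₀ : ℂ) r) := fun n =>
    (differentiable_pottsPair _ _ _ n).1.comp_differentiableOn hζ
  have hBd : ∀ n, DifferentiableOn ℂ (B n) (ball (x₀ : ℂ) r) := fun n =>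
    (differentiable_pottsPair _ _ _ n).2.comp_differentiableOn hζ
  set N : ℕ → ℂ → ℝ := fun n X => ‖pottsPair (t : ℂ) κ c (ζ X) n‖ with hN
  have hNmax : ∀ n X, N n X = max ‖A n X‖ ‖B n X‖ := fun n X => rfl
  have hAN : ∀ n X, ‖A n X‖ ≤ N n X := fun n X => le_max_left _ _
  have hBN : ∀ n X, ‖B n X‖ ≤ N n X := fun n X => le_max_right _ _
  have hA1 : ∀ n X, A (n + 1) X = A n X ^ 2 + κ * ζ X * B n X ^ 2 := fun n X => rfl
  have hB1 : ∀ n X, B (n + 1) X = t * A n X ^ 2 + c * ζ X * B n X ^ 2 := fun n X => rfl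
  have hN0 : ∀ n X, 0 ≤ N n X := fun n X => norm_nonneg _
  have hfac : ∀ n X, A n X ^ 3 + m * ζ X * B n X ^ 3 = (A n X + β X * B n X) *
      (A n X ^ 2 - A n X * (β X * B n X) + (β X * B n X) ^ 2) := fun n X => by
    rw [← hβ3]; ring
  have hprod : ∀ n, ∀ X ∈ ball (x₀ : ℂ) r, (A n X + β X * B n X) *
      (A n X ^ 2 - A n X * (β X * B n X) + (β X * B n X) ^ 2) ≠ 0 := fun n X hX => by
    rw [← hfac]; exact hE X hX n
  have hpos : ∀ n, ∀ x : ℝ, (x : ℂ) ∈ ball (x₀ : ℂ) r → ∃ a b y : ℝ, 0 < a ∧ 0 < b ∧ 0 < y ∧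
      A n x = a ∧ B n x = b ∧ β x = y := by
    intro n x hx
    obtain ⟨y, hy, e⟩ := hreal x hx
    obtain ⟨y', hy', e'⟩ := hβre x hx
    obtain ⟨h1, h2⟩ := h.pair_pos hy n
    refine ⟨_, _, y', h1, h2, hy', ?_, ?_, e'⟩ <;> simp [hA, hB, e, pottsPair_ofReal]
  have hBβ : ∀ n, ∀ X ∈ ball (x₀ : ℂ) r, ‖B n X‖ ≤ k * ‖β X * B n X‖ := by
    intro n X hX
    calc ‖B n X‖ = ‖(β X)⁻¹‖ * ‖β X * B n X‖ := by
          rw [← norm_mul, inv_mul_cancel_left₀ (hβ0 X hX)]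
      _ ≤ _ := by gcongr; exact hkβ' X hX
  obtain ⟨ρ, F, h1, h2, h3, h4, h5⟩ := exists_holomorphic_normalizer (x₀ := x₀) hr
    (K := 8 * k ^ 3) (N := N) (L₁ := fun n X => A n X + β X * B n X)
    (L₂ := fun n X => A n X ^ 2 - A n X * (β X * B n X) + (β X * B n X) ^ 2)
    (by linarith)
    (fun n X hX => by
      refine norm_pos_iff.2 fun h0 => hE X hX n ?_
      simp [h0])
    (fun X _ => by
      simp only [hN, pottsPair]
      simp
      linarith)
    (fun n X hX => by
      rw [hNmax (n + 1), hA1, hB1]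
      have hz := hkζ X hX
      have ha : ‖A n X‖ ^ 2 ≤ N n X ^ 2 := by gcongr; exact hAN n X
      have hb : ‖B n X‖ ^ 2 ≤ N n X ^ 2 := by gcongr; exact hBN n X
      have hN2 := sq_nonneg (N n X)
      refine max_le ?_ ?_
      · calc ‖A n X ^ 2 + κ * ζ X * B n X ^ 2‖ ≤ ‖A n X‖ ^ 2 + κ * ‖ζ X‖ * ‖B n X‖ ^ 2 := by
              refine (norm_add_le _ _).trans (le_of_eq ?_)
              simp [abs_of_pos hκ]
          _ ≤ N n X ^ 2 + k * k * N n X ^ 2 := by gcongr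
          _ ≤ _ := by nlinarith
      · calc ‖t * A n X ^ 2 + c * ζ X * B n X ^ 2‖ ≤
              t * ‖A n X‖ ^ 2 + c * ‖ζ X‖ * ‖B n X‖ ^ 2 := by
              refine (norm_add_le _ _).trans (le_of_eq ?_)
              simp [abs_of_pos hc, abs_of_pos ht]
          _ ≤ k * N n X ^ 2 + k * k * N n X ^ 2 := by gcongr
          _ ≤ _ := by nlinarith)
    (fun n X hX => by
      have hz := hkζ' X hX
      have ha : ‖A n X‖ ^ 2 ≤ 2 * k ^ 2 * N (n + 1) X := by
        have e : A n X ^ 2 = ((t * κ - c : ℝ) : ℂ)⁻¹ * (κ * B (n + 1) X - c * A (n + 1) X) := by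
          have : ((t * κ - c : ℝ) : ℂ) ≠ 0 := Complex.ofReal_ne_zero.2 hd.ne'
          rw [eq_inv_mul_iff_mul_eq₀ this, hA1, hB1]
          push_cast
          ring
        have := congrArg norm e
        rw [norm_pow, norm_mul, norm_inv, Complex.norm_real, Real.norm_of_nonneg hd.le] at this
        rw [this]
        calc _ ≤ k * (κ * ‖B (n + 1) X‖ + c * ‖A (n + 1) X‖) := by
              gcongr
              refine (norm_sub_le _ _).trans (le_of_eq ?_)
              simp [abs_of_pos hκ, abs_of_pos hc]
          _ ≤ k * (k * N (n + 1) X + k * N (n + 1) X) := by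
              gcongr
              · exact hBN _ _
              · exact hAN _ _
          _ = _ := by ring
      have hb : ‖B n X‖ ^ 2 ≤ 2 * k ^ 3 * N (n + 1) X := by
        have e : B n X ^ 2 = (ζ X)⁻¹ * (((t * κ - c : ℝ) : ℂ)⁻¹ *
            (t * A (n + 1) X - B (n + 1) X)) := by
          have : ((t * κ - c : ℝ) : ℂ) ≠ 0 := Complex.ofReal_ne_zero.2 hd.ne'
          rw [eq_inv_mul_iff_mul_eq₀ (hζ0 X hX), eq_inv_mul_iff_mul_eq₀ this, hA1, hB1]
          push_cast
          ring
        have := congrArg norm e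
        rw [norm_pow, norm_mul, norm_mul, norm_inv ((t * κ - c : ℝ) : ℂ), Complex.norm_real,
          Real.norm_of_nonneg hd.le] at this
        rw [this]
        calc _ ≤ k * (k * (t * ‖A (n + 1) X‖ + 1 * ‖B (n + 1) X‖)) := by
              gcongr
              refine (norm_sub_le _ _).trans (le_of_eq ?_)
              simp [abs_of_pos ht]
          _ ≤ k * (k * (k * N (n + 1) X + k * N (n + 1) X)) := by
              gcongr
              · exact hAN _ _
              · exact hBN _ _
          _ = _ := by ring
      have hN1 := hN0 (n + 1) X
      have hAk : 2 * k ^ 2 * N (n + 1) X ≤ 8 * k ^ 3 * N (n + 1) X := by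
        gcongr
        norm_num
      have hBk : 2 * k ^ 3 * N (n + 1) X ≤ 8 * k ^ 3 * N (n + 1) X := by
        gcongr
        norm_num
      rcases max_choice ‖A n X‖ ‖B n X‖ with e | e <;> rw [hNmax n, e] <;> linarith)
    (fun n => (hAd n).add (hβd.mul (hBd n)))
    (fun n => (((hAd n).pow 2).sub ((hAd n).mul (hβd.mul (hBd n)))).add
      ((hβd.mul (hBd n)).pow 2))
    (fun n X hX => left_ne_zero_of_mul (hprod n X hX))
    (fun n X hX => right_ne_zero_of_mul (hprod n X hX))
    (fun n X hX => by
      calc ‖A n X + β X * B n X‖ ≤ ‖A n X‖ + ‖β X‖ * ‖B n X‖ := by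
            refine (norm_add_le _ _).trans (le_of_eq ?_)
            simp
        _ ≤ N n X + k * N n X := by
            gcongr
            · exact hAN _ _
            · exact hkβ X hX
            · exact hBN _ _
        _ ≤ _ := by nlinarith [hN0 n X])
    (fun n X hX => by
      calc ‖A n X ^ 2 - A n X * (β X * B n X) + (β X * B n X) ^ 2‖ ≤
            ‖A n X‖ ^ 2 + ‖A n X‖ * (‖β X‖ * ‖B n X‖) + (‖β X‖ * ‖B n X‖) ^ 2 := by
            refine (norm_add_le _ _).trans (add_le_add ((norm_sub_le _ _).trans ?_) ?_) <;> simp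
        _ ≤ N n X ^ 2 + N n X * (k * N n X) + (k * N n X) ^ 2 := by
            have := hkβ X hX
            have := hAN n X
            have := hBN n X
            have := hN0 n X
            gcongr
        _ ≤ _ := by nlinarith [sq_nonneg (N n X)])
    (fun n X hX => by
      obtain ⟨hv, ha⟩ := sq_norm_le_max_factors (A n X) (β X * B n X)
      set μ := max (‖A n X + β X * B n X‖ ^ 2)
        ‖A n X ^ 2 - A n X * (β X * B n X) + (β X * B n X) ^ 2‖
      have hμ : 0 ≤ μ := (sq_nonneg _).trans (le_max_left _ _)
      have hb : ‖B n X‖ ^ 2 ≤ 3 * k ^ 2 * μ := by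
        calc ‖B n X‖ ^ 2 ≤ (k * ‖β X * B n X‖) ^ 2 := by gcongr; exact hBβ n X hX
          _ = k ^ 2 * ‖β X * B n X‖ ^ 2 := by ring
          _ ≤ k ^ 2 * (3 * μ) := by gcongr
          _ = _ := by ring
      have e1 : 3 * k ^ 2 * μ ≤ 8 * k ^ 3 * μ := by
        gcongr
        norm_num
      have e2 : 8 * μ ≤ 8 * k ^ 3 * μ := by
        gcongr
        linarith
      rcases max_choice ‖A n X‖ ‖B n X‖ with e | e <;> rw [hNmax n, e] <;> linarith)
    (fun n x hx => by
      obtain ⟨a, b, y, ha, hb, hy, ea, eb, ey⟩ := hpos n x hx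
      have hb' := hBβ n x hx
      rw [eb, ey, ← Complex.ofReal_mul, Complex.norm_real, Complex.norm_real,
        Real.norm_of_nonneg hb.le, Real.norm_of_nonneg (by positivity)] at hb'
      have hyb : 0 < y * b := by positivity
      refine ⟨a + y * b, by positivity, by rw [ea, eb, ey]; push_cast; ring, ?_⟩
      rw [hNmax, ea, eb, Complex.norm_real, Complex.norm_real, Real.norm_of_nonneg hb.le,
        Real.norm_of_nonneg ha.le]
      refine max_le ?_ ?_ <;> nlinarith)
    (fun n x hx => by
      obtain ⟨a, b, y, ha, hb, hy, ea, eb, ey⟩ := hpos n x hx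
      have hb' := hBβ n x hx
      rw [eb, ey, ← Complex.ofReal_mul, Complex.norm_real, Complex.norm_real,
        Real.norm_of_nonneg hb.le, Real.norm_of_nonneg (by positivity)] at hb'
      have hyb : 0 < y * b := by positivity
      have hL : a ^ 2 + (y * b) ^ 2 ≤ 2 * (a ^ 2 - a * (y * b) + (y * b) ^ 2) := by
        nlinarith [sq_nonneg (a - y * b)]
      have ha2 : 0 < a ^ 2 := by positivity
      have hyb2 : 0 < (y * b) ^ 2 := by positivity
      have hb2 : b ^ 2 ≤ k ^ 2 * (y * b) ^ 2 := by
        rw [← mul_pow]; gcongr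
      refine ⟨a ^ 2 - a * (y * b) + (y * b) ^ 2, by linarith,
        by rw [ea, eb, ey]; push_cast; ring, ?_⟩
      have hk31 : 1 ≤ k ^ 3 := by linarith
      rcases max_choice ‖A n x‖ ‖B n x‖ with e | e <;> rw [hNmax n, e]
      · rw [ea, Complex.norm_real, Real.norm_of_nonneg ha.le]
        nlinarith
      · rw [eb, Complex.norm_real, Real.norm_of_nonneg hb.le]
        have : k ^ 2 * (y * b) ^ 2 ≤ k ^ 3 * (y * b) ^ 2 := by gcongr
        nlinarith)
  exact ⟨8 * k ^ 3, ρ, F, by positivity, h1, h2, h3, h4, h5⟩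

end PottsParams

/-- A nonzero quadratic with positive leading coefficient is positive somewhere in every punctured
neighbourhood of a root. -/
theorem frequently_quadratic_pos {a b e x₀ : ℝ} (ha : 0 < a) (h0 : a * x₀ ^ 2 - b * x₀ + e = 0) :
    ∃ᶠ x in 𝓝[≠] x₀, 0 < a * x ^ 2 - b * x + e := by
  intro hev
  obtain ⟨δ, hδ, hb⟩ := Metric.eventually_nhds_iff.1 (eventually_nhdsWithin_iff.1 hev)
  have h1 := hb (y := x₀ + δ / 2) (by simp [abs_of_pos hδ]; linarith) (by simp [hδ.ne'])
  have h2 := hb (y := x₀ - δ / 2) (by simp [abs_of_pos hδ]; linarith) (by simp [hδ.ne'])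
  have h3 := mul_pos ha (mul_pos hδ hδ)
  nlinarith

/-- If the projective size of a sequence of pairs dominates its deviation from the line of slope
`X`, then the ratios converge to `X`. -/
theorem tendsto_div_of_tendsto_sub_mul_div {a b : ℕ → ℂ} {X : ℂ} {K : ℝ} {G : ℕ → ℂ}
    (hG : ∀ n, G n ≠ 0) (hK : 0 < K) (hle : ∀ n, ‖G n‖ ≤ K * ‖(a n, b n)‖)
    (hlim : Tendsto (fun n => (a n - X * b n) / G n) atTop (𝓝 0)) :
    (∀ᶠ n in atTop, b n ≠ 0) ∧ Tendsto (fun n => a n / b n) atTop (𝓝 X) := by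
  have hX := norm_nonneg X
  have hev : ∀ᶠ n in atTop, ‖G n‖ ≤ 2 * K * (1 + ‖X‖) * ‖b n‖ := by
    have h1 : ∀ᶠ n in atTop, ‖(a n - X * b n) / G n‖ < (2 * K)⁻¹ := by
      have := hlim.norm
      rw [norm_zero] at this
      exact this.eventually_lt_const (by positivity)
    filter_upwards [h1] with n hn
    rw [norm_div, div_lt_iff₀ (norm_pos_iff.2 (hG n))] at hn
    have h2 : ‖a n‖ ≤ ‖a n - X * b n‖ + ‖X‖ * ‖b n‖ := by
      rw [← norm_mul]
      simpa using norm_add_le (a n - X * b n) (X * b n)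
    have h3 : ‖(a n, b n)‖ ≤ ‖a n - X * b n‖ + (1 + ‖X‖) * ‖b n‖ := by
      refine max_le ?_ ?_
      · dsimp only
        linarith [norm_nonneg (b n)]
      · dsimp only
        nlinarith [norm_nonneg (b n), norm_nonneg (a n - X * b n)]
    have h4 : ‖G n‖ ≤ K * ((2 * K)⁻¹ * ‖G n‖ + (1 + ‖X‖) * ‖b n‖) :=
      (hle n).trans (by gcongr; linarith)
    have h5 : K * ((2 * K)⁻¹ * ‖G n‖) = ‖G n‖ / 2 := by field_simp
    rw [mul_add, h5] at h4
    linarith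
  have hb : ∀ᶠ n in atTop, b n ≠ 0 := by
    filter_upwards [hev] with n hn h0
    rw [h0, norm_zero, mul_zero] at hn
    exact hG n (norm_le_zero_iff.1 hn)
  refine ⟨hb, ?_⟩
  rw [tendsto_iff_norm_sub_tendsto_zero]
  have h0 := (hlim.norm.const_mul (2 * K * (1 + ‖X‖)))
  rw [norm_zero, mul_zero] at h0
  refine squeeze_zero' (Eventually.of_forall fun n => norm_nonneg _) ?_ h0
  filter_upwards [hev, hb] with n hn hbn
  have hbn' := norm_pos_iff.2 hbn
  rw [div_sub' hbn, norm_div, norm_div, mul_div_assoc', div_le_div_iff₀ hbn'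
    (norm_pos_iff.2 (hG n)), mul_comm (b n) X]
  nlinarith [norm_nonneg (a n - X * b n)]

/-- A sequence of functions analytic on a connected open set whose complement has empty interior
and not identically zero has a common point of nonvanishing in every nonempty open set. -/
theorem exists_forall_ne_zero_of_analyticOnNhd {f : ℕ → ℂ → ℂ} {s x₀ : ℂ}
    (hf : ∀ n, AnalyticOnNhd ℂ (f n) {s}ᶜ) (hx₀ : x₀ ≠ s) (h0 : ∀ n, f n x₀ ≠ 0) {U : Set ℂ}
    (hU : IsOpen U) (hne : U.Nonempty) : ∃ X ∈ U, X ≠ s ∧ ∀ n, f n X ≠ 0 := by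
  have hconn : IsPreconnected ({s}ᶜ : Set ℂ) :=
    (isConnected_compl_singleton_of_one_lt_rank (by simp [Complex.rank_real_complex]) s).isPreconnected
  have hopen : ∀ n, IsOpen ({s}ᶜ ∩ f n ⁻¹' {0}ᶜ) := fun n =>
    (hf n).continuousOn.isOpen_inter_preimage isOpen_compl_singleton isOpen_compl_singleton
  have hdense : ∀ n, Dense ({s}ᶜ ∩ f n ⁻¹' {0}ᶜ) := by
    intro n
    rw [dense_iff_inter_open]
    intro V hV hVne
    by_contra hcon
    obtain ⟨y, hyV, hys⟩ := (dense_compl_singleton s).inter_open_nonempty V hV hVne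
    refine h0 n ((hf n).eqOn_zero_of_preconnected_of_eventuallyEq_zero hconn hys ?_ hx₀)
    filter_upwards [hV.mem_nhds hyV, isOpen_compl_singleton.mem_nhds hys] with w hwV hws
    by_contra hw
    exact hcon ⟨w, hwV, hws, hw⟩
  obtain ⟨X, hXU, hX⟩ := (dense_iInter_of_isOpen_nat hopen hdense).inter_open_nonempty U hU hne
  rw [mem_iInter] at hX
  exact ⟨X, hXU, (hX 0).1, fun n => (hX n).2⟩

namespace PottsParams

variable {t κ c : ℝ}

/-- The multiplier of the fixed point `X` is larger than one in norm at points arbitrarily close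
to a parabolic fixed point. -/
theorem frequently_one_lt_multiplier (h : PottsParams t κ c) {x₀ : ℝ} (hx₀ : x₀ ≠ 0)
    (hR : 2 * t * c * x₀ ^ 2 - (t * κ + 3 * c) * x₀ + 2 * κ = 0) :
    ∃ᶠ X : ℂ in 𝓝 (x₀ : ℂ), 1 < ‖2 * (1 - t * X) * (κ - c * X) / (X * (t * κ - c))‖ := by
  have hd := h.d_pos
  have hdc : (t * κ - c : ℂ) ≠ 0 := by exact_mod_cast hd.ne'
  set f : ℂ → ℂ := fun X => 2 * (1 - t * X) * (κ - c * X) / (X * (t * κ - c)) with hf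
  have hfe : ∀ X : ℂ, X ≠ 0 → f X =
      (2 * t * c * X ^ 2 - (t * κ + 3 * c) * X + 2 * κ) / (X * (t * κ - c)) - 1 := by
    intro X hX
    simp only [hf]
    field_simp
    ring
  have hx₀c : (x₀ : ℂ) ≠ 0 := Complex.ofReal_ne_zero.2 hx₀
  have hRc : (2 * t * c * (x₀ : ℂ) ^ 2 - (t * κ + 3 * c) * x₀ + 2 * κ) = 0 := by exact_mod_cast hR
  have hfx : f x₀ = -1 := by rw [hfe _ hx₀c, hRc]; simp
  intro hev
  have hmax : IsLocalMax (norm ∘ f) (x₀ : ℂ) := by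
    filter_upwards [hev] with X hX
    simpa only [Function.comp_apply, hfx, norm_neg, norm_one, not_lt] using hX
  have hdiff : ∀ᶠ X in 𝓝 (x₀ : ℂ), DifferentiableAt ℂ f X := by
    filter_upwards [isOpen_compl_singleton.mem_nhds hx₀c] with X hX
    exact DifferentiableAt.div (by fun_prop) (by fun_prop) (mul_ne_zero hX hdc)
  have hconst := (Complex.eventually_eq_of_isLocalMax_norm hdiff hmax).and
    (isOpen_compl_singleton.mem_nhds hx₀c)
  have hreal := (Complex.continuous_ofReal.tendsto x₀).eventually hconst
  obtain ⟨x, hx, hxc, hx0⟩ := ((frequently_quadratic_pos (a := 2 * t * c) (b := t * κ + 3 * c)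
    (by have := h.t_pos; have := h.c_pos; positivity) hR).and_eventually
      (hreal.filter_mono nhdsWithin_le_nhds)).exists
  rw [hfe _ hx0, hfx, sub_eq_neg_self, div_eq_zero_iff] at hxc
  rcases hxc with e | e
  · exact hx.ne' (by exact_mod_cast e)
  · exact mul_ne_zero hx0 hdc e

/-- Critical positive parameters are accumulated by zeros of the partition functions. -/
theorem frequently_exists_zero (h : PottsParams t κ c) {z₀ m : ℝ} (hz₀ : 0 < z₀) (hm : 0 < m)
    (hQ : 4 * t * c ^ 3 * z₀ ^ 2 - ((t * κ) ^ 2 - 6 * (t * κ) * c - 3 * c ^ 2) * z₀ + 4 * κ = 0) :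
    ∃ᶠ z in 𝓝 (z₀ : ℂ), ∃ n, (pottsPair (t : ℂ) κ c z n).1 ^ 3 +
      m * z * (pottsPair (t : ℂ) κ c z n).2 ^ 3 = 0 := by
  by_contra hcon
  have hev : ∀ᶠ z in 𝓝 (z₀ : ℂ), ∀ n, (pottsPair (t : ℂ) κ c z n).1 ^ 3 +
      m * z * (pottsPair (t : ℂ) κ c z n).2 ^ 3 ≠ 0 := by
    simpa [not_frequently] using hcon
  have hc := h.c_pos
  have hd := h.d_pos
  have hdc : (t * κ - c : ℂ) ≠ 0 := by exact_mod_cast hd.ne'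
  obtain ⟨x₀, hx₀, hfix, hR⟩ := h.exists_parabolic hz₀ hQ
  obtain ⟨hv, hu⟩ := h.fixed_pos hz₀ hx₀ hfix
  have hx1 : x₀ ≠ 1 := by
    rintro rfl
    have := h.base_pos
    linarith
  set ζ : ℂ → ℂ := fun X => X ^ 2 * (t * X - 1) / (κ - c * X) with hζ
  have huc : (κ - c * (x₀ : ℂ)) ≠ 0 := by exact_mod_cast hu.ne'
  have hζx : ∀ {x : ℝ}, ζ x = ((x ^ 2 * (t * x - 1) / (κ - c * x) : ℝ) : ℂ) := fun {x} => by
    simp [hζ]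
  have hζ₀ : ζ x₀ = z₀ := by rw [hζx, hfix, mul_div_cancel_right₀ _ hu.ne']
  have hζc : ContinuousAt ζ x₀ := ContinuousAt.div (by fun_prop) (by fun_prop) huc
  have hz₀c : (z₀ : ℂ) ≠ 0 := Complex.ofReal_ne_zero.2 hz₀.ne'
  have hgood : ∀ᶠ X : ℂ in 𝓝 (x₀ : ℂ), κ - c * X ≠ 0 ∧ m * ζ X ∈ Complex.slitPlane ∧
      (∀ n, (pottsPair (t : ℂ) κ c (ζ X) n).1 ^ 3 +
        m * ζ X * (pottsPair (t : ℂ) κ c (ζ X) n).2 ^ 3 ≠ 0) ∧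
      ‖ζ X‖ < ‖(z₀ : ℂ)‖ + 1 ∧ ‖(ζ X)⁻¹‖ < ‖(z₀ : ℂ)⁻¹‖ + 1 ∧
      0 < X.re ∧ 0 < (t * X - 1).re ∧ 0 < (κ - c * X).re := by
    refine Eventually.and ?_ (Eventually.and ?_ (Eventually.and ?_ (Eventually.and ?_
      (Eventually.and ?_ (Eventually.and ?_ (Eventually.and ?_ ?_))))))
    · exact ContinuousAt.eventually_ne (by fun_prop) huc
    · refine ContinuousAt.eventually_mem (f := fun X => m * ζ X) (by fun_prop)
        (Complex.isOpen_slitPlane.mem_nhds ?_)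
      rw [hζ₀, ← Complex.ofReal_mul, Complex.ofReal_mem_slitPlane]
      positivity
    · exact hζc.eventually (by rw [hζ₀]; exact hev)
    · exact hζc.norm.tendsto.eventually_lt_const (by simp only [hζ₀]; linarith)
    · have hinv := (hζc.inv₀ (by rw [hζ₀]; exact hz₀c)).norm.tendsto
      rw [Pi.inv_apply, hζ₀] at hinv
      exact hinv.eventually_lt_const (by linarith)
    · exact Complex.continuous_re.continuousAt.tendsto.eventually_const_lt (by simpa using hx₀)
    · have : ContinuousAt (fun X : ℂ => (t * X - 1).re) x₀ := by fun_prop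
      exact this.tendsto.eventually_const_lt (by simpa using hv)
    · have : ContinuousAt (fun X : ℂ => (κ - c * X).re) x₀ := by fun_prop
      exact this.tendsto.eventually_const_lt (by simpa using hu)
  obtain ⟨r, hr, hgood⟩ := Metric.eventually_nhds_iff_ball.1 hgood
  have hζd : DifferentiableOn ℂ ζ (ball (x₀ : ℂ) r) :=
    DifferentiableOn.div (by fun_prop) (by fun_prop) fun X hX => (hgood X hX).1
  have hreal : ∀ x : ℝ, (x : ℂ) ∈ ball (x₀ : ℂ) r → 0 < x ∧ ∃ y : ℝ, 0 < y ∧ ζ x = y ∧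
      x ^ 2 * (t * x - 1) = y * (κ - c * x) := by
    intro x hx
    obtain ⟨-, -, -, -, -, h1, h2, h3⟩ := hgood x hx
    simp only [Complex.ofReal_re, ← Complex.ofReal_mul, ← Complex.ofReal_sub,
      ← Complex.ofReal_one] at h1 h2 h3
    exact ⟨h1, x ^ 2 * (t * x - 1) / (κ - c * x), by positivity, hζx,
      (div_mul_cancel₀ _ h3.ne').symm⟩
  obtain ⟨K, ρ, F, hK, hρ, hρr, hFd, hF0, hF⟩ := h.exists_pair_normalizer hr hm hζd
    (M := max (‖(z₀ : ℂ)‖ + 1) (‖(z₀ : ℂ)⁻¹‖ + 1))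
    (fun X hX => (hgood X hX).2.1)
    (fun x hx => by obtain ⟨-, y, hy, e, -⟩ := hreal x hx; exact ⟨y, hy, e⟩)
    (fun X hX => (hgood X hX).2.2.2.1.le.trans (le_max_left _ _))
    (fun X hX => (hgood X hX).2.2.2.2.1.le.trans (le_max_right _ _))
    (fun X hX => (hgood X hX).2.2.1)
  have hsub : ball (x₀ : ℂ) ρ ⊆ ball (x₀ : ℂ) r := ball_subset_ball hρr
  set A : ℕ → ℂ → ℂ := fun n X => (pottsPair (t : ℂ) κ c (ζ X) n).1 with hA
  set B : ℕ → ℂ → ℂ := fun n X => (pottsPair (t : ℂ) κ c (ζ X) n).2 with hB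
  have hG0 : ∀ n, ∀ X ∈ ball (x₀ : ℂ) ρ, F X ^ 2 ^ n ≠ 0 := fun n X hX =>
    pow_ne_zero _ (hF0 X hX)
  have hPd : ∀ n, DifferentiableOn ℂ (fun X => (A n X - X * B n X) / F X ^ 2 ^ n)
      (ball (x₀ : ℂ) ρ) := fun n =>
    DifferentiableOn.div
      (((differentiable_pottsPair _ _ _ n).1.comp_differentiableOn (hζd.mono hsub)).sub
        (differentiableOn_id.mul
          ((differentiable_pottsPair _ _ _ n).2.comp_differentiableOn (hζd.mono hsub))))
      (hFd.pow _) (hG0 n)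
  have hbound : ∀ n, ∀ X ∈ ball (x₀ : ℂ) ρ, ‖(A n X, B n X)‖ / ‖F X ^ 2 ^ n‖ ≤ K := by
    intro n X hX
    rw [div_le_iff₀ (norm_pos_iff.2 (hG0 n X hX)), norm_pow]
    exact (hF n X hX).2
  have hPC : ∀ n, ∀ X ∈ ball (x₀ : ℂ) ρ, ‖(A n X - X * B n X) / F X ^ 2 ^ n‖ ≤
      (1 + (‖(x₀ : ℂ)‖ + ρ)) * K := by
    intro n X hX
    have hXn : ‖X‖ ≤ ‖(x₀ : ℂ)‖ + ρ := by
      have h1 := norm_sub_norm_le X (x₀ : ℂ)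
      have h2 := (mem_ball_iff_norm.1 hX).le
      linarith
    have h1 : ‖A n X - X * B n X‖ ≤ (1 + (‖(x₀ : ℂ)‖ + ρ)) * ‖(A n X, B n X)‖ := by
      calc ‖A n X - X * B n X‖ ≤ ‖A n X‖ + ‖X‖ * ‖B n X‖ := by
            rw [← norm_mul]; exact norm_sub_le _ _
        _ ≤ ‖(A n X, B n X)‖ + (‖(x₀ : ℂ)‖ + ρ) * ‖(A n X, B n X)‖ := by
            gcongr
            · exact le_max_left _ _
            · exact le_max_right _ _
        _ = _ := by ring
    calc _ = ‖A n X - X * B n X‖ / ‖F X ^ 2 ^ n‖ := norm_div _ _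
      _ ≤ (1 + (‖(x₀ : ℂ)‖ + ρ)) * ‖(A n X, B n X)‖ / ‖F X ^ 2 ^ n‖ := by gcongr
      _ = (1 + (‖(x₀ : ℂ)‖ + ρ)) * (‖(A n X, B n X)‖ / ‖F X ^ 2 ^ n‖) := mul_div_assoc _ _ _
      _ ≤ _ := by gcongr; exact hbound n X hX
  have hfreq : ∃ᶠ X in 𝓝[≠] (x₀ : ℂ),
      Tendsto (fun n => (A n X - X * B n X) / F X ^ 2 ^ n) atTop (𝓝 0) := by
    refine (tendsto_ofReal_nhdsNE x₀).frequently ?_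
    have hball : ∀ᶠ x : ℝ in 𝓝[≠] x₀, (x : ℂ) ∈ ball (x₀ : ℂ) ρ :=
      ((Complex.continuous_ofReal.tendsto x₀).eventually_mem (ball_mem_nhds _ hρ)).filter_mono
        nhdsWithin_le_nhds
    refine ((frequently_quadratic_pos (a := 2 * t * c) (b := t * κ + 3 * c)
      (by have := h.t_pos; positivity) hR).and_eventually hball).mono ?_
    rintro x ⟨hRx, hxb⟩
    obtain ⟨hx, y, hy, ey, hyfix⟩ := hreal x (hsub hxb)
    have hlim := h.tendsto_fixed hy hx hyfix hRx
    rw [tendsto_iff_norm_sub_tendsto_zero] at hlim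
    have h0 := hlim.const_mul K
    rw [mul_zero] at h0
    refine squeeze_zero_norm (fun n => ?_) h0
    have hBx : B n x = ((pottsPair t κ c y n).2 : ℝ) := by simp [hB, ey, pottsPair_ofReal]
    have hAx : A n x = ((pottsPair t κ c y n).1 : ℝ) := by simp [hA, ey, pottsPair_ofReal]
    have hb := (h.pair_pos hy n).2
    have e : A n x - x * B n x = B n x * ((pottsRatio t κ c y n - x : ℝ) : ℂ) := by
      rw [hAx, hBx, pottsRatio]
      norm_cast
      field_simp
    rw [e, norm_div, norm_mul, Complex.norm_real (pottsRatio t κ c y n - x), mul_div_right_comm]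
    gcongr
    refine le_trans ?_ (hbound n x hxb)
    gcongr
    exact le_max_right _ _
  have hconv : ∀ X ∈ ball (x₀ : ℂ) (ρ / 4), (∀ᶠ n in atTop, B n X ≠ 0) ∧
      Tendsto (fun n => A n X / B n X) atTop (𝓝 X) := by
    intro X hX
    have hXρ : X ∈ ball (x₀ : ℂ) ρ := ball_subset_ball (by linarith) hX
    refine tendsto_div_of_tendsto_sub_mul_div (G := fun n => F X ^ 2 ^ n)
      (fun n => hG0 n X hXρ) hK (fun n => ?_) ?_
    · rw [norm_pow]
      exact (hF n X hXρ).1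
    · rw [Metric.tendsto_nhds]
      intro ε hε
      filter_upwards [eventually_norm_le_of_frequently_tendsto_zero hρ hPd hPC hfreq
        (half_pos hε)] with n hn
      rw [dist_zero_right]
      linarith [hn X hX]
  have hne0 : ∀ n, A n x₀ - x₀ * B n x₀ ≠ 0 := fun n => by
    simp only [hA, hB, hζ₀, pottsPair_ofReal]
    exact_mod_cast h.pair_sub_fixed_ne_zero hz₀ hx₀ hfix hx1 n
  obtain ⟨X₀, hX₀, hX₀b⟩ := ((h.frequently_one_lt_multiplier hx₀.ne' hR).and_eventually
    ((ball_mem_nhds (x₀ : ℂ) (show 0 < ρ / 4 by linarith)))).exists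
  have hpos : ∀ X ∈ ball (x₀ : ℂ) (ρ / 4), X ≠ 0 := fun X hX h0 => by
    have := (hgood X (hsub (ball_subset_ball (by linarith) hX))).2.2.2.2.2.1
    simp [h0] at this
  have hUopen : IsOpen (ball (x₀ : ℂ) (ρ / 4) ∩
      (fun X : ℂ => ‖2 * (1 - t * X) * (κ - c * X) / (X * (t * κ - c))‖) ⁻¹' Ioi 1) := by
    refine ContinuousOn.isOpen_inter_preimage ?_ isOpen_ball isOpen_Ioi
    refine ContinuousOn.norm (ContinuousOn.div (by fun_prop) (by fun_prop) fun X hX => ?_)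
    exact mul_ne_zero (hpos X hX) hdc
  obtain ⟨X, ⟨hXb, hXm⟩, -, hX⟩ := exists_forall_ne_zero_of_analyticOnNhd
    (f := fun n X => A n X - X * B n X) (s := κ / c) (x₀ := x₀) (fun n => by
      have hζs : DifferentiableOn ℂ ζ {(κ / c : ℂ)}ᶜ :=
        DifferentiableOn.div (by fun_prop) (by fun_prop) fun X hX h0 => hX (by
          have hcc : (c : ℂ) ≠ 0 := Complex.ofReal_ne_zero.2 hc.ne'
          rw [mem_singleton_iff, eq_div_iff hcc]
          linear_combination -h0)
      refine DifferentiableOn.analyticOnNhd ?_ isOpen_compl_singleton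
      exact ((differentiable_pottsPair _ _ _ n).1.comp_differentiableOn hζs).sub
        (differentiableOn_id.mul
          ((differentiable_pottsPair _ _ _ n).2.comp_differentiableOn hζs)))
    (fun e => huc (by
      have hcc : (c : ℂ) ≠ 0 := Complex.ofReal_ne_zero.2 hc.ne'
      rw [e, mul_div_cancel₀ _ hcc, sub_self])) hne0 hUopen ⟨X₀, hX₀b, hX₀⟩
  have hXr := hgood X (hsub (ball_subset_ball (by linarith) hXb))
  have hX0 := hpos X hXb
  have hXu := hXr.1
  obtain ⟨hBev, hlim⟩ := hconv X hXb
  have hXfix : X ^ 2 * (t * X - 1) = ζ X * (κ - c * X) := (div_mul_cancel₀ _ hXu).symm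
  have hden : (t * X ^ 2 + c * ζ X) * (κ - c * X) = X ^ 2 * (t * κ - c) := by
    linear_combination -c * hXfix
  have hden0 : t * X ^ 2 + c * ζ X ≠ 0 := fun h0 => by
    rw [h0, zero_mul] at hden
    exact mul_ne_zero (pow_ne_zero 2 hX0) hdc hden.symm
  obtain ⟨n, hn⟩ := exists_pottsPair_eq_of_repelling (κ := (κ : ℂ)) hXfix hBev hlim hden0 (by
    refine lt_of_mul_lt_mul_right ?_ (norm_nonneg (κ - c * X))
    rw [← norm_mul, hden, ← norm_mul]
    simp only [mem_preimage, mem_Ioi] at hXm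
    rw [norm_div, one_lt_div (norm_pos_iff.2 (mul_ne_zero hX0 hdc))] at hXm
    have h1 := mul_lt_mul_of_pos_left hXm (norm_pos_iff.2 hX0)
    rw [← norm_mul, ← norm_mul] at h1
    calc ‖X ^ 2 * (t * κ - c)‖ = ‖X * (X * (t * κ - c))‖ := by congr 1; ring
      _ < _ := h1
      _ = _ := by congr 1; ring)
  exact hX n hn

end PottsParams

theorem pottsPair_succ {K : Type*} [CommSemiring K] (t κ c z : K) (n : ℕ) :
    pottsPair t κ c z (n + 1) =
      ((pottsPair t κ c z n).1 ^ 2 + κ * z * (pottsPair t κ c z n).2 ^ 2,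
        t * (pottsPair t κ c z n).1 ^ 2 + c * z * (pottsPair t κ c z n).2 ^ 2) := rfl

/-- The conditional partition functions in homogeneous coordinates. -/
theorem exists_ZZpair_eq_smul_pottsPair (q : ℕ) (t : ℝ) {z : ℂ} (hz : z ≠ 0) (n : ℕ) :
    ∃ s : ℂ, s ≠ 0 ∧
      (ZZpair q t n z).1 + ((q : ℂ) - 1) * t * (ZZpair q t n z).2 =
        s * (pottsPair (t : ℂ) (((q : ℂ) - 1) * t) (1 + ((q : ℂ) - 2) * t) z (n + 1)).1 ∧
      t * (ZZpair q t n z).1 + (1 + ((q : ℂ) - 2) * t) * (ZZpair q t n z).2 =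
        s * (pottsPair (t : ℂ) (((q : ℂ) - 1) * t) (1 + ((q : ℂ) - 2) * t) z (n + 1)).2 := by
  induction n with
  | zero =>
    refine ⟨z⁻¹, inv_ne_zero hz, ?_, ?_⟩ <;> simp only [ZZpair, pottsPair] <;> field_simp
  | succ n ih =>
    obtain ⟨s, hs, h1, h2⟩ := ih
    refine ⟨z⁻¹ * s ^ 2, mul_ne_zero (inv_ne_zero hz) (pow_ne_zero _ hs), ?_, ?_⟩
    · rw [ZZpair, h1, h2, pottsPair_succ _ _ _ _ (n + 1)]
      field_simp
    · rw [ZZpair, h1, h2, pottsPair_succ _ _ _ _ (n + 1)]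
      field_simp

theorem Zunrooted_eq_zero_iff (q : ℕ) (t : ℝ) {z : ℂ} (hz : z ≠ 0) {n : ℕ} (hn : 1 ≤ n) :
    Zunrooted q t n z = 0 ↔
      (pottsPair (t : ℂ) (((q - 1) * t : ℝ) : ℂ) ((1 + (q - 2) * t : ℝ) : ℂ) z n).1 ^ 3 +
      ((q - 1 : ℝ) : ℂ) * z *
        (pottsPair (t : ℂ) (((q - 1) * t : ℝ) : ℂ) ((1 + (q - 2) * t : ℝ) : ℂ) z n).2 ^ 3 = 0 := by
  obtain ⟨s, hs, h1, h2⟩ := exists_ZZpair_eq_smul_pottsPair q t hz (n - 1)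
  rw [Nat.sub_add_cancel hn] at h1 h2
  rw [Zunrooted, h1, h2]
  push_cast
  conv_rhs => rw [← mul_eq_zero_iff_left (mul_ne_zero (inv_ne_zero hz) (pow_ne_zero 3 hs))]
  congr! 1
  field_simp

theorem pottsParams_of_three_le {q : ℕ} (hq : 3 ≤ q) {t : ℝ} (ht : 1 < t) :
    PottsParams t ((q - 1) * t) (1 + (q - 2) * t) := by
  have hq' : (3 : ℝ) ≤ q := by exact_mod_cast hq
  refine ⟨ht, by nlinarith, by ring, ?_⟩
  have : 0 < (t - 1) * ((q - 3) * t + 3) := by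
    have := mul_nonneg (sub_nonneg.2 hq') (by linarith : (0 : ℝ) ≤ t)
    exact mul_pos (by linarith) (by linarith)
  linarith

/-- The positive points of the accumulation set are the roots of an explicit quadratic. -/
theorem ofReal_mem_BLYhat_iff {q : ℕ} (hq : 3 ≤ q) {t κ c : ℝ} (ht : 1 < t)
    (hκ : κ = (q - 1) * t) (hc : c = 1 + (q - 2) * t) {x : ℝ} (hx : 0 < x) :
    (x : ℂ) ∈ BLYhat t q ↔
      4 * t * c ^ 3 * x ^ 2 - ((t * κ) ^ 2 - 6 * (t * κ) * c - 3 * c ^ 2) * x + 4 * κ = 0 := by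
  have h : PottsParams t κ c := by rw [hκ, hc]; exact pottsParams_of_three_le hq ht
  have hm : (0 : ℝ) < q - 1 := by
    have : (3 : ℝ) ≤ q := by exact_mod_cast hq
    linarith
  have hxc : (x : ℂ) ≠ 0 := Complex.ofReal_ne_zero.2 hx.ne'
  rw [BLYhat, mem_closure_iff_frequently]
  constructor
  · intro hfreq
    by_contra hQ
    refine hfreq ((h.eventually_forall_ne_zero hx hm hQ).mono ?_)
    rintro z hz ⟨hz0, n, hn, hzero⟩
    rw [Zunrooted_eq_zero_iff q t hz0 hn, ← hκ, ← hc] at hzero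
    exact hz n hzero
  · intro hQ
    have h0 : ∀ᶠ z in 𝓝 (x : ℂ), z ≠ 0 ∧ 1 + ((q - 1 : ℝ) : ℂ) * z ≠ 0 := by
      refine (eventually_ne_nhds hxc).and (ContinuousAt.eventually_ne (by fun_prop) ?_)
      have : 0 < 1 + (q - 1 : ℝ) * x := by positivity
      exact_mod_cast this.ne'
    refine ((h.frequently_exists_zero hx hm hQ).and_eventually h0).mono ?_
    rintro z ⟨⟨n, hn⟩, hz0, hz1⟩
    have hn1 : 1 ≤ n := by
      rcases Nat.eq_zero_or_pos n with rfl | hpos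
      · simp only [pottsPair] at hn
        exact absurd (by simpa using hn) hz1
      · exact hpos
    refine ⟨hz0, n, hn1, ?_⟩
    rw [Zunrooted_eq_zero_iff q t hz0 hn1, ← hκ, ← hc]
    exact hn

theorem lt_tThree_iff {q t : ℝ} (hq : 3 ≤ q) (ht : 1 < t) :
    t < tThree q ↔ t * ((q - 1) * t) < 9 * (1 + (q - 2) * t) := by
  have hΔ : 0 ≤ 9 * q ^ 2 - 32 * q + 32 := by nlinarith
  set s := √(9 * q ^ 2 - 32 * q + 32) with hs
  have hs2 : s ^ 2 = 9 * q ^ 2 - 32 * q + 32 := Real.sq_sqrt hΔ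
  have hs3 : 3 * q - 6 ≤ s := Real.le_sqrt_of_sq_le (by nlinarith)
  have hpos : 0 < 2 * (q - 1) * t - 9 * (q - 2) + 3 * s := by nlinarith
  have e : (2 * (q - 1) * t - 9 * (q - 2) - 3 * s) * (2 * (q - 1) * t - 9 * (q - 2) + 3 * s) =
      4 * (q - 1) * (t * ((q - 1) * t) - 9 * (1 + (q - 2) * t)) := by
    linear_combination -9 * hs2
  rw [tThree, ← hs, lt_div_iff₀ (by linarith)]
  have hq1 : 0 < 4 * (q - 1) := by linarith
  constructor
  · intro h
    have h1 : (2 * (q - 1) * t - 9 * (q - 2) - 3 * s) *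
        (2 * (q - 1) * t - 9 * (q - 2) + 3 * s) < 0 := mul_neg_of_neg_of_pos (by linarith) hpos
    rw [e] at h1
    have := neg_of_mul_neg_right h1 hq1.le
    linarith
  · intro h
    have h1 : 4 * (q - 1) * (t * ((q - 1) * t) - 9 * (1 + (q - 2) * t)) < 0 :=
      mul_neg_of_pos_of_neg hq1 (by linarith)
    rw [← e] at h1
    have := neg_of_mul_neg_left h1 hpos.le
    linarith

theorem critical_quadratic_pos {t κ c x : ℝ} (ht : 0 < t) (hc : 0 < c) (hlt : c < t * κ)
    (h9 : t * κ < 9 * c) :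
    0 < 4 * t * c ^ 3 * x ^ 2 - ((t * κ) ^ 2 - 6 * (t * κ) * c - 3 * c ^ 2) * x + 4 * κ := by
  have hD : 0 < (t * κ - c) ^ 3 * (9 * c - t * κ) :=
    mul_pos (pow_pos (by linarith) 3) (by linarith)
  have h1 : 0 < 16 * t * c ^ 3 := by positivity
  refine (mul_pos_iff_of_pos_left h1).1 ?_
  have e : 16 * t * c ^ 3 * (4 * t * c ^ 3 * x ^ 2 -
      ((t * κ) ^ 2 - 6 * (t * κ) * c - 3 * c ^ 2) * x + 4 * κ) =
      (8 * t * c ^ 3 * x - ((t * κ) ^ 2 - 6 * (t * κ) * c - 3 * c ^ 2)) ^ 2 +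
        (t * κ - c) ^ 3 * (9 * c - t * κ) := by ring
  rw [e]
  positivity

end

/-- **Theorem B (unrooted case).** For `q ≥ 3` and `t > 1`, the intersection of the
accumulation set of Lee–Yang zeros of the unrooted binary Cayley tree with `(0,∞)` is
empty for `1 < t < t₃(q)` and equals `{z_c^−(t,q), z_c^+(t,q)}` for `t ≥ t₃(q)`. -/
theorem potts_unrooted_antiferromagnetic_accumulation
    (q : ℕ) (hq : 3 ≤ q) (t : ℝ) (ht : 1 < t) :
    (t < tThree q → BLYhat t q ∩ posAxis = ∅) ∧
    (tThree q ≤ t →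
      BLYhat t q ∩ posAxis = {((zcMinus q t : ℝ) : ℂ), ((zcPlus q t : ℝ) : ℂ)}) := by
  have hq' : (3 : ℝ) ≤ q := by exact_mod_cast hq
  have hpar := pottsParams_of_three_le hq ht
  have hiff := lt_tThree_iff hq' ht
  have hmem := fun x (hx : 0 < x) => ofReal_mem_BLYhat_iff hq ht rfl rfl hx
  obtain ⟨κ, hκ⟩ : ∃ κ : ℝ, κ = (q - 1) * t := ⟨_, rfl⟩
  obtain ⟨c, hc⟩ : ∃ c : ℝ, c = 1 + (q - 2) * t := ⟨_, rfl⟩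
  rw [← hκ, ← hc] at hpar hiff
  simp only [← hκ, ← hc] at hmem
  have ht0 := hpar.t_pos
  have hc0 := hpar.c_pos
  have hd := hpar.d_pos
  constructor
  · intro hlt
    rw [hiff] at hlt
    refine Set.eq_empty_iff_forall_notMem.2 ?_
    rintro _ ⟨hz, x, hx, rfl⟩
    rw [hmem x hx] at hz
    exact (critical_quadratic_pos ht0 hc0 (sub_pos.1 hd) hlt).ne' hz
  · intro hle
    rw [← not_lt, hiff, not_lt] at hle
    set N := (t * κ) ^ 2 - 6 * (t * κ) * c - 3 * c ^ 2 with hN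
    have hD : 0 ≤ (t * κ - c) ^ 3 * (t * κ - 9 * c) :=
      mul_nonneg (pow_pos hd 3).le (sub_nonneg.2 hle)
    set s := √((t * κ - c) ^ 3 * (t * κ - 9 * c)) with hs
    have hs2 : s ^ 2 = (t * κ - c) ^ 3 * (t * κ - 9 * c) := Real.sq_sqrt hD
    have hs0 : 0 ≤ s := Real.sqrt_nonneg _
    have hden : 0 < 8 * t * c ^ 3 := by positivity
    have hN0 : 0 < N := by
      have : N = (t * κ + 3 * c) * (t * κ - 9 * c) + 24 * c ^ 2 := by rw [hN]; ring
      rw [this]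
      have := mul_nonneg (by linarith : 0 ≤ t * κ + 3 * c) (sub_nonneg.2 hle)
      positivity
    have hsN : s < N := by
      refine lt_of_pow_lt_pow_left₀ 2 hN0.le ?_
      have : N ^ 2 - s ^ 2 = 64 * (t * κ) * c ^ 3 := by rw [hs2, hN]; ring
      have : 0 < 64 * (t * κ) * c ^ 3 := by
        have := hpar.κ_pos
        positivity
      linarith
    have harg : (t - 1) ^ 3 * (1 - t + q * t) ^ 3 *
        (-9 + 18 * t - 9 * q * t - t ^ 2 + q * t ^ 2) =
        (t * κ - c) ^ 3 * (t * κ - 9 * c) := by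
      rw [hκ, hc]; ring
    have hplus : zcPlus q t = (N + s) / (8 * t * c ^ 3) := by
      rw [zcPlus, harg, ← hs]
      congr 1
      · rw [hN, hκ, hc]; ring
      · rw [hc]; ring
    have hminus : zcMinus q t = (N - s) / (8 * t * c ^ 3) := by
      rw [zcMinus, harg, ← hs]
      congr 1
      · rw [hN, hκ, hc]; ring
      · rw [hc]; ring
    have hroots : ∀ x : ℝ, 4 * t * c ^ 3 * x ^ 2 - N * x + 4 * κ = 0 ↔
        x = zcPlus q t ∨ x = zcMinus q t := by
      intro x
      have := quadratic_eq_zero_iff (a := 4 * t * c ^ 3) (b := -N) (c := 4 * κ) (s := s)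
        (by positivity) (by rw [discrim, ← sq, hs2, hN]; ring) x
      rw [hplus, hminus]
      rw [neg_neg, show 2 * (4 * t * c ^ 3) = 8 * t * c ^ 3 by ring] at this
      rw [← this]
      congr! 1
      ring
    have hplus0 : 0 < zcPlus q t := by rw [hplus]; exact div_pos (by linarith) hden
    have hminus0 : 0 < zcMinus q t := by rw [hminus]; exact div_pos (by linarith) hden
    ext z
    constructor
    · rintro ⟨hz, x, hx, rfl⟩
      rw [hmem x hx, hroots] at hz
      rcases hz with rfl | rfl
      · exact Or.inr rfl
      · exact Or.inl rfl
    · rintro (rfl | rfl)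
      · exact ⟨(hmem _ hminus0).2 ((hroots _).2 (Or.inr rfl)), _, hminus0, rfl⟩
      · exact ⟨(hmem _ hplus0).2 ((hroots _).2 (Or.inl rfl)), _, hplus0, rfl⟩
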